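/- Let 𝒜 be a C*-algebra, let E be a Banach space, and let 0 < p < 1. Then every p-summing operator T : 𝒜 → E is compact. -/

import Mathlib

open MeasureTheory ENNReal

/-- `T : X → Y` is `p`-summing (`0 < p < ∞`) if there is `C ≥ 0` such that for every finite
family `x₁, …, xₙ` in `X` one has
`(∑ ‖T xᵢ‖ᵖ)^{1/p} ≤ C · sup { (∑ |⟨xᵢ, x*⟩|ᵖ)^{1/p} : x* ∈ X*, ‖x*‖ ≤ 1 }`. -/
def PSumming (p : ℝ) {X Y : Type*} [NormedAddCommGroup X] [NormedSpace ℂ X]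
    [NormedAddCommGroup Y] [NormedSpace ℂ Y] (T : X →L[ℂ] Y) : Prop :=
  ∃ C : ℝ, 0 ≤ C ∧ ∀ (n : ℕ) (x : Fin n → X),
    (∑ i, ‖T (x i)‖ ^ p) ^ (1 / p) ≤
      C * sSup {r : ℝ | ∃ φ : StrongDual ℂ X, ‖φ‖ ≤ 1 ∧
        r = (∑ i, ‖φ (x i)‖ ^ p) ^ (1 / p)}

namespace PS
open Finset

def red {V : Type*} [Add V] (x : ℕ → V) : ℕ → V := fun s => x (2*s) + x (2*s+1)
def dif {V : Type*} [Sub V] (x : ℕ → V) : ℕ → V := fun s => x (2*s) - x (2*s+1)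

lemma sum_two {V : Type*} [AddCommMonoid V] (x : ℕ → V) (N : ℕ) :
    ∑ s ∈ range N, (x (2*s) + x (2*s+1)) = ∑ n ∈ range (2*N), x n := by
  induction N with
  | zero => simp
  | succ N ih =>
    rw [sum_range_succ, ih, show 2*(N+1) = 2*N+1+1 by ring, sum_range_succ, sum_range_succ, add_assoc]

lemma sum_red {V : Type*} [AddCommMonoid V] (x : ℕ → V) (k : ℕ) :
    ∑ s ∈ range (2^k), red x s = ∑ n ∈ range (2^(k+1)), x n := by
  rw [pow_succ', ← sum_two]; rfl

lemma rpow_ineq {p x : ℝ} (hp0 : 0 < p) (hp1 : p < 1) (hx0 : 0 ≤ x) (hx2 : x ≤ 2) :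
    x ^ p ≤ 1 + p*(x-1) - (p*(1-p)/6)*(x-1)^2 := by
  set s := Real.sqrt x with hs
  have hs0 : 0 ≤ s := Real.sqrt_nonneg x
  have hss : s^2 = x := Real.sq_sqrt hx0
  have h1 : s ^ p ≤ 1 + p*(s-1) := by
    have := rpow_one_add_le_one_add_mul_self (s := s-1) (by linarith) hp0.le hp1.le
    simpa using this
  have h2 : x ^ p = (s^p)^2 := by
    rw [← hss, ← Real.rpow_natCast, ← Real.rpow_natCast, ← Real.rpow_mul hs0, ← Real.rpow_mul hs0, mul_comm]
  have h3 : 0 ≤ s^p := Real.rpow_nonneg hs0 p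
  have h4 : (s^p)^2 ≤ (1 + p*(s-1))^2 := by gcongr
  have hs15 : s ≤ 1.42 := by
    by_contra h; push Not at h; nlinarith
  have h5 : (s+1)^2 ≤ 6 := by nlinarith
  have h6 : (x-1)^2 ≤ 6*(s-1)^2 := by
    have : (x-1)^2 = (s-1)^2*(s+1)^2 := by rw [← hss]; ring
    rw [this]; nlinarith [sq_nonneg (s-1)]
  have h7 : (1 + p*(s-1))^2 = 1 + p*(x-1) - p*(1-p)*(s-1)^2 := by rw [← hss]; ring
  have : 0 < p*(1-p) := by nlinarith
  rw [h2]; nlinarith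

lemma two_point {p V w : ℝ} (hp0 : 0 < p) (hp1 : p < 1) (hw : |w| ≤ V) :
    (V+w)^p + (V-w)^p ≤ 2*V^p - 2*((p*(1-p)/6) * (w^2*V^(p-2))) := by
  have hw' := abs_le.1 hw
  rcases eq_or_lt_of_le ((abs_nonneg w).trans hw) with h | h
  · have : w = 0 := by rw [← h] at hw; exact abs_nonpos_iff.1 hw
    simp [← h, this, hp0.ne']
  · have h1 : (1+w/V)^p ≤ _ := rpow_ineq hp0 hp1 (x := 1 + w/V)
      (by have : -1 ≤ w/V := by rw [le_div_iff₀ h]; linarith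
          linarith)
      (by have : w/V ≤ 1 := by rw [div_le_iff₀ h]; linarith
          linarith)
    have h2 : (1-w/V)^p ≤ _ := rpow_ineq hp0 hp1 (x := 1 - w/V)
      (by have : w/V ≤ 1 := by rw [div_le_iff₀ h]; linarith
          linarith)
      (by have : -1 ≤ w/V := by rw [le_div_iff₀ h]; linarith
          linarith)
    have a1 : V+w = V*(1+w/V) := by field_simp
    have a2 : V-w = V*(1-w/V) := by field_simp
    have a3 : V^(p-2) = V^p / V^2 := by rw [Real.rpow_sub h]; norm_num
    have hq : 0 < V^p := Real.rpow_pos_of_pos h p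
    rw [a1, a2, a3, Real.mul_rpow h.le, Real.mul_rpow h.le]
    · have : w^2*(V^p/V^2) = V^p*(w/V)^2 := by field_simp
      rw [this]; nlinarith
    · have : w/V ≤ 1 := by rw [div_le_iff₀ h]; linarith
      linarith
    · have : -1 ≤ w/V := by rw [le_div_iff₀ h]; linarith
      linarith

lemma abs_rpow_le {p V w τ : ℝ} (hp0 : 0 < p) (hp1 : p < 1) (hw : |w| ≤ V) (hτ : 0 < τ) :
    |w|^p ≤ τ*V^p + τ^(1-2/p)*(w^2*V^(p-2)) := by
  rcases eq_or_lt_of_le ((abs_nonneg w).trans hw) with h | h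
  · have : w = 0 := by rw [← h] at hw; exact abs_nonpos_iff.1 hw
    simp [← h, this, hp0.ne']
  · have a3 : V^(p-2) = V^p / V^2 := by rw [Real.rpow_sub h]; norm_num
    have hq : 0 < V^p := Real.rpow_pos_of_pos h p
    have key : ∀ r : ℝ, 0 ≤ r → r^p ≤ τ + τ^(1-2/p)*r^2 := by
      intro r hr
      have e0 : 0 < τ^(1-2/p) := Real.rpow_pos_of_pos hτ _
      by_cases hc : r^p ≤ τ
      · nlinarith [sq_nonneg r]
      · push Not at hc
        have hr0 : 0 < r := by
          rcases hr.eq_or_lt with h' | h'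
          · rw [← h', Real.zero_rpow hp0.ne'] at hc; linarith
          · exact h'
        have h1 : τ^(1/p) ≤ r := by
          have := Real.rpow_le_rpow hτ.le hc.le (z := 1/p) (by positivity)
          rwa [← Real.rpow_mul hr, mul_one_div_cancel hp0.ne', Real.rpow_one] at this
        have h2 : r^(p-2) ≤ (τ^(1/p))^(p-2) :=
          Real.rpow_le_rpow_of_nonpos (Real.rpow_pos_of_pos hτ _) h1 (by linarith)
        rw [← Real.rpow_mul hτ.le] at h2
        have h3 : 1/p*(p-2) = 1-2/p := by field_simp
        rw [h3, Real.rpow_sub hr0] at h2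
        have h4 : r^(2:ℝ) = r^2 := by norm_num
        rw [h4, div_le_iff₀ (by positivity)] at h2
        linarith
    have hk := key (|w|/V) (by positivity)
    rw [Real.div_rpow (abs_nonneg _) h.le, div_pow, sq_abs, div_le_iff₀ hq] at hk
    rw [a3]
    calc |w|^p ≤ _ := hk
      _ = _ := by field_simp

/-- normalised p-sum at level k -/
noncomputable def lev (p : ℝ) (k : ℕ) (F : ℕ → ℝ) : ℝ :=
  ((2:ℝ)^k)⁻¹ * ∑ s ∈ range (2^k), ((2:ℝ)^k * |F s|)^p

lemma lev_step {p τ : ℝ} (hp0 : 0 < p) (hp1 : p < 1) (hτ : 0 < τ) (F : ℕ → ℝ) (hF : ∀ n, 0 ≤ F n) (k : ℕ) :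
    lev p (k+1) F ≤ lev p k (red F) ∧
    lev p k (dif F) ≤ τ * lev p k (red F) +
      (τ^(1-2/p)/(p*(1-p)/6)) * (lev p k (red F) - lev p (k+1) F) := by
  set c := p*(1-p)/6 with hc
  have hc0 : 0 < c := by have : 0 < 1 - p := by linarith
                         positivity
  set q : ℝ := ((2:ℝ)^k)⁻¹ * ∑ s ∈ range (2^k), ((2:ℝ)^k * dif F s)^2*((2:ℝ)^k * red F s)^(p-2) with hq
  have hr : ∀ s, 0 ≤ red F s := fun s => add_nonneg (hF _) (hF _)
  have hd : ∀ s, |(2:ℝ)^k * dif F s| ≤ (2:ℝ)^k * red F s := by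
    intro s
    rw [abs_mul, abs_of_pos (by positivity : (0:ℝ) < 2^k)]
    gcongr
    simp only [dif, red]
    rw [abs_le]; constructor <;> linarith [hF (2*s), hF (2*s+1)]
  have hq0 : 0 ≤ q := by
    refine mul_nonneg (by positivity) (sum_nonneg fun s _ => mul_nonneg (sq_nonneg _) (Real.rpow_nonneg (mul_nonneg (by positivity) (hr s)) _))
  have h1 : lev p (k+1) F ≤ lev p k (red F) - c*q := by
    have e1 : lev p (k+1) F = ((2:ℝ)^k)⁻¹ * ∑ s ∈ range (2^k),
        (((2:ℝ)^k * red F s + (2:ℝ)^k * dif F s)^p + ((2:ℝ)^k * red F s - (2:ℝ)^k * dif F s)^p)/2 := by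
      unfold lev
      rw [show (2:ℕ)^(k+1) = 2*2^k from pow_succ' 2 k, ← sum_two, ← sum_div]
      have : ∀ s, (2:ℝ)^(k+1)*|F (2*s)| = (2:ℝ)^k * red F s + (2:ℝ)^k * dif F s ∧
        (2:ℝ)^(k+1)*|F (2*s+1)| = (2:ℝ)^k * red F s - (2:ℝ)^k * dif F s := by
        intro s
        rw [abs_of_nonneg (hF _), abs_of_nonneg (hF _)]
        simp only [red, dif]
        constructor <;> ring
      simp only [(this _).1, (this _).2]
      rw [pow_succ, mul_inv]; ring
    rw [e1]
    have e2 : lev p k (red F) - c*q = ((2:ℝ)^k)⁻¹ * ∑ s ∈ range (2^k),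
       (2*((2:ℝ)^k * red F s)^p - 2*(c*(((2:ℝ)^k * dif F s)^2*((2:ℝ)^k * red F s)^(p-2))))/2 := by
      unfold lev
      rw [hq]
      simp only [abs_of_nonneg (hr _)]
      rw [← sum_div, sum_sub_distrib, ← mul_sum, ← mul_sum, ← mul_sum]; ring
    rw [e2]
    gcongr with s hs
    exact two_point hp0 hp1 (hd s)
  have h2 : lev p k (dif F) ≤ τ * lev p k (red F) + τ^(1-2/p) * q := by
    have e2 : τ * lev p k (red F) + τ^(1-2/p) * q = ((2:ℝ)^k)⁻¹ * ∑ s ∈ range (2^k),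
       (τ*((2:ℝ)^k * red F s)^p + τ^(1-2/p)*(((2:ℝ)^k * dif F s)^2*((2:ℝ)^k * red F s)^(p-2))) := by
      unfold lev
      rw [hq]
      simp only [abs_of_nonneg (hr _)]
      rw [sum_add_distrib, ← mul_sum, ← mul_sum]; ring
    rw [e2]; unfold lev
    gcongr with s hs
    have := abs_rpow_le hp0 hp1 (hd s) hτ
    rwa [abs_mul, abs_of_pos (by positivity : (0:ℝ) < 2^k)] at this
  have e0 : 0 < τ^(1-2/p) := Real.rpow_pos_of_pos hτ _
  refine ⟨by nlinarith, h2.trans ?_⟩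
  refine add_le_add le_rfl ?_
  rw [div_mul_eq_mul_div, le_div_iff₀ hc0, mul_assoc]
  refine mul_le_mul_of_nonneg_left ?_ e0.le
  linarith

lemma mart {p τ : ℝ} (hp0 : 0 < p) (hp1 : p < 1) (hτ : 0 < τ) (L : ℕ) : ∀ (F : ℕ → ℝ) (_ : ∀ n, 0 ≤ F n)
    (_ : ∑ n ∈ range (2^L), F n ≤ 1), lev p L F ≤ 1 ∧
    ∑ j ∈ range L, lev p (L-1-j) (dif (red^[j] F)) ≤ τ*L + (τ^(1-2/p)/(p*(1-p)/6))*(1 - lev p L F) := by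
  have hc0 : 0 < p*(1-p)/6 := by have : 0 < 1 - p := by linarith
                                 positivity
  have e0 : 0 < τ^(1-2/p) := Real.rpow_pos_of_pos hτ _
  induction L with
  | zero =>
    intro F hF h1
    have : lev p 0 F ≤ 1 := by
      simp [lev] at *
      rw [abs_of_nonneg (hF 0)]
      exact Real.rpow_le_one (hF 0) h1 hp0.le
    refine ⟨this, ?_⟩
    simp only [range_zero, sum_empty, Nat.cast_zero, mul_zero, zero_add]
    exact mul_nonneg (div_pos e0 hc0).le (by linarith)
  | succ L ih =>
    intro F hF h1
    obtain ⟨i1, i2⟩ := ih (red F) (fun s => add_nonneg (hF _) (hF _)) (by rwa [sum_red])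
    obtain ⟨s1, s2⟩ := lev_step hp0 hp1 hτ F hF L
    refine ⟨s1.trans i1, ?_⟩
    rw [sum_range_succ']
    have e1 : ∀ j, lev p (L+1-1-(j+1)) (dif (red^[j+1] F)) = lev p (L-1-j) (dif (red^[j] (red F))) := by
      intro j
      rw [show L+1-1-(j+1) = L-1-j by omega]; rfl
    have e2 : lev p (L+1-1-0) (dif (red^[0] F)) = lev p L (dif F) := rfl
    rw [sum_congr rfl (fun j _ => e1 j), e2]
    push_cast
    have : τ * lev p L (red F) ≤ τ := by nlinarith
    linarith
end PS

namespace PS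
open Finset

lemma quad_le {q d s : ℝ} (h : ∀ r : ℝ, 0 ≤ q*(r*r) + d*r + s) : d^2 ≤ 4*q*s := by
  have := discrim_le_zero h
  unfold discrim at this; linarith

lemma bcs {V : Type*} [AddCommGroup V] [Module ℝ V] (b : V →ₗ[ℝ] V →ₗ[ℝ] ℝ)
    (hs : ∀ x y, b x y = b y x) (hp : ∀ x, 0 ≤ b x x) (x y : V) :
    |b x y| ≤ Real.sqrt (b x x) * Real.sqrt (b y y) := by
  have : (2*b x y)^2 ≤ 4 * b y y * b x x := by
    apply quad_le
    intro r
    have := hp (x + r • y)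
    simp only [map_add, map_smul, LinearMap.add_apply, LinearMap.smul_apply, smul_eq_mul] at this
    rw [hs y x] at this
    linarith
  rw [← Real.sqrt_mul (hp x)]
  apply Real.abs_le_sqrt
  nlinarith

lemma sakai {V : Type*} [AddCommGroup V] [Module ℝ V] (b : V →ₗ[ℝ] V →ₗ[ℝ] ℝ)
    (hs : ∀ x y, b x y = b y x) (hp : ∀ x, 0 ≤ b x x) (C : Set V) (hC : Convex ℝ C) (hne : C.Nonempty)
    (D : ℝ) (hD : ∀ v ∈ C, ∀ x ∈ C, b (v-x) (v-x) ≤ D)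
    (z : V →ₗ[ℝ] ℝ) (K : ℝ) (hz : ∀ u, z u^2 ≤ K * b u u)
    (hyp : ∀ u, ∀ η > 0, ∃ v ∈ C, z u - η ≤ b v u) (η : ℝ) (hη : 0 < η) :
    ∃ x ∈ C, ∀ a, |z a - b x a| ≤ η * Real.sqrt (b a a) := by
  have hD0 : 0 ≤ D := by
    obtain ⟨x, hx⟩ := hne
    have := hD x hx x hx; simpa using this
  set B := 4 + D + 2*Real.sqrt D with hB
  have hB0 : 4 ≤ B := by have := Real.sqrt_nonneg D; linarith
  set δ := min 1 (min (η/2) (η^2/4/B)) with hδ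
  have hδ0 : 0 < δ := by positivity
  have hδ1 : δ ≤ 1 := min_le_left _ _
  have hδ2 : δ ≤ η/2 := (min_le_right _ _).trans (min_le_left _ _)
  have hδ3 : δ*B ≤ (η/2)^2 := by
    have : δ ≤ η^2/4/B := (min_le_right _ _).trans (min_le_right _ _)
    rw [le_div_iff₀ (by linarith)] at this
    linarith [show (η/2)^2 = η^2/4 by ring]
  set Φ : V → ℝ := fun x => b x x - 2 * z x with hΦ
  have hlow : ∀ x, -|K| ≤ Φ x := by
    intro x
    have h1 : (2*z x)^2 ≤ (|K| + b x x)^2 := by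
      have := hz x
      have h2 : K * b x x ≤ |K| * b x x := mul_le_mul_of_nonneg_right (le_abs_self K) (hp x)
      nlinarith [sq_nonneg (|K| - b x x)]
    have := abs_le_of_sq_le_sq' h1 (add_nonneg (abs_nonneg K) (hp x))
    simp only [hΦ]; linarith
  have near : ∀ S : Set V, S.Nonempty → ∀ ε > 0, ∃ x ∈ S, ∀ y ∈ S, Φ x ≤ Φ y + ε := by
    intro S hS ε hε
    have hb : BddBelow (Φ '' S) := ⟨-|K|, by rintro _ ⟨x, _, rfl⟩; exact hlow x⟩
    obtain ⟨_, ⟨x, hx, rfl⟩, hlt⟩ := exists_lt_of_csInf_lt (hS.image Φ) (lt_add_of_pos_right (sInf (Φ '' S)) hε)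
    refine ⟨x, hx, fun y hy => ?_⟩
    have := csInf_le hb ⟨y, hy, rfl⟩
    linarith
  have expand : ∀ x u (t : ℝ), Φ (x + t • u) = Φ x + 2*t*(b x u - z u) + t^2*b u u := by
    intro x u t
    simp only [hΦ, map_add, map_smul, LinearMap.add_apply, LinearMap.smul_apply, smul_eq_mul]
    rw [hs u x]; ring
  obtain ⟨x, hx, hxm⟩ := near C hne (δ^2) (by positivity)
  obtain ⟨w, -, hwm⟩ := near Set.univ Set.univ_nonempty (δ^2) (by positivity)
  have h1 : ∀ v ∈ C, z (v-x) - b x (v-x) ≤ δ*(1+D)/2 := by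
    intro v hv
    have h2 := hxm (x + δ • (v-x)) (hC.add_smul_sub_mem hx hv ⟨hδ0.le, hδ1⟩)
    rw [expand] at h2
    have h3 := hD v hv x hx
    have h4 : δ^2*b (v-x) (v-x) ≤ δ^2*D := by gcongr
    have h5 : δ * (2*(z (v-x) - b x (v-x))) ≤ δ * (δ*(1+D)) := by nlinarith
    have := le_of_mul_le_mul_left h5 hδ0
    linarith
  have h2 : ∀ u, |z u - b w u| ≤ δ * Real.sqrt (b u u) := by
    intro u
    have : (2*(b w u - z u))^2 ≤ 4 * b u u * δ^2 := by
      apply quad_le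
      intro r
      have := hwm (w + r • u) trivial
      rw [expand] at this
      linarith
    rw [← Real.sqrt_sq hδ0.le, ← Real.sqrt_mul (by positivity)]
    apply Real.abs_le_sqrt
    nlinarith
  set u := w - x with hu
  set N := Real.sqrt (b u u) with hN
  have hN0 : 0 ≤ N := Real.sqrt_nonneg _
  have hNN : N^2 = b u u := Real.sq_sqrt (hp u)
  have hNη : N ≤ η/2 := by
    obtain ⟨v, hv, hv2⟩ := hyp u δ hδ0
    have a1 := abs_le.1 (h2 u)
    have a2 : b (v-x) u = b w (v-x) - b x (v-x) := by
      rw [hu, map_sub, hs (v-x) w, hs (v-x) x]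
    have a3 := abs_le.1 (h2 (v-x))
    have a4 : δ * Real.sqrt (b (v-x) (v-x)) ≤ δ * Real.sqrt D := by
      gcongr; exact hD v hv x hx
    have a5 := h1 v hv
    have a6 : b u u = b w u - b x u := by
      rw [← LinearMap.sub_apply, ← map_sub]
    have a7 : b (v-x) u = b v u - b x u := by simp
    have a8 : δ*N ≤ δ^2/2 + N^2/2 := by nlinarith [sq_nonneg (δ - N)]
    have a9 : δ^2 ≤ δ := by nlinarith
    have : N^2 ≤ (η/2)^2 := by
      refine le_trans ?_ hδ3
      rw [hB]
      nlinarith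
    exact abs_le_of_sq_le_sq' this (by positivity) |>.2
  refine ⟨x, hx, fun a => ?_⟩
  have e : z a - b x a = (z a - b w a) + b u a := by simp [hu]
  rw [e]
  calc _ ≤ |z a - b w a| + |b u a| := abs_add_le _ _
    _ ≤ δ * Real.sqrt (b a a) + N * Real.sqrt (b a a) := add_le_add (h2 a) (bcs b hs hp u a)
    _ ≤ _ := by
      rw [← add_mul]; gcongr; linarith
end PS

namespace PS
open Finset

def PSum' (p : ℝ) {X Y : Type*} [NormedAddCommGroup X] [NormedSpace ℂ X]
    [NormedAddCommGroup Y] [NormedSpace ℂ Y] (T : X →L[ℂ] Y) (C : ℝ) : Prop :=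
  0 ≤ C ∧ ∀ {ι : Type} (s : Finset ι) (x : ι → X) (B : ℝ),
    (∀ φ : StrongDual ℂ X, ‖φ‖ ≤ 1 → ∑ i ∈ s, ‖φ (x i)‖^p ≤ B) → ∑ i ∈ s, ‖T (x i)‖^p ≤ C * B

lemma psum' {p : ℝ} (hp : 0 < p) {X Y : Type*} [NormedAddCommGroup X] [NormedSpace ℂ X]
    [NormedAddCommGroup Y] [NormedSpace ℂ Y] (T : X →L[ℂ] Y) (h : PSumming p T) :
    ∃ C, PSum' p T C := by
  obtain ⟨C, hC, h⟩ := h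
  refine ⟨C^p, Real.rpow_nonneg hC p, ?_⟩
  intro ι s x B hB
  have hB0 : 0 ≤ B := by
    have := hB 0 (by simp)
    refine le_trans ?_ this
    exact sum_nonneg fun i _ => by positivity
  have h1 := h s.card (fun i => x (s.equivFin.symm i))
  have e1 : ∀ (g : X → ℝ), ∑ i : Fin s.card, g (x (s.equivFin.symm i)) = ∑ i ∈ s, g (x i) := by
    intro g
    rw [← Finset.sum_coe_sort s (fun i => g (x i))]
    exact Equiv.sum_comp s.equivFin.symm (fun i => g (x i))
  have h2 : sSup {r : ℝ | ∃ φ : StrongDual ℂ X, ‖φ‖ ≤ 1 ∧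
        r = (∑ i, ‖φ (x (s.equivFin.symm i))‖ ^ p) ^ (1 / p)} ≤ B^(1/p) := by
    apply csSup_le
    · exact ⟨_, 0, by simp, rfl⟩
    · rintro r ⟨φ, hφ, rfl⟩
      rw [e1 (fun y => ‖φ y‖^p)]
      exact Real.rpow_le_rpow (sum_nonneg fun i _ => by positivity) (hB φ hφ) (by positivity)
  rw [e1 (fun y => ‖T y‖^p)] at h1
  have h3 := h1.trans (mul_le_mul_of_nonneg_left h2 hC)
  have hS : 0 ≤ ∑ i ∈ s, ‖T (x i)‖^p := sum_nonneg fun i _ => by positivity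
  have h4 := Real.rpow_le_rpow (Real.rpow_nonneg hS _) h3 hp.le
  rwa [← Real.rpow_mul hS, one_div_mul_cancel hp.ne', Real.rpow_one, Real.mul_rpow hC (by positivity),
    ← Real.rpow_mul hB0, one_div_mul_cancel hp.ne', Real.rpow_one] at h4

lemma one_sum {p : ℝ} (hp : 0 < p) (hp1 : p < 1) {X Y : Type*} [NormedAddCommGroup X] [NormedSpace ℂ X]
    [NormedAddCommGroup Y] [NormedSpace ℂ Y] (T : X →L[ℂ] Y) {C : ℝ} (h : PSum' p T C) :
    PSum' 1 T (C^(1/p)) := by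
  obtain ⟨hC, h⟩ := h
  refine ⟨Real.rpow_nonneg hC _, ?_⟩
  intro ι s x B hB
  simp only [Real.rpow_one] at *
  set S := ∑ i ∈ s, ‖T (x i)‖ with hSd
  have hS : 0 ≤ S := sum_nonneg fun i _ => by positivity
  have hB0 : 0 ≤ B := by
    have := hB 0 (by simp)
    refine le_trans ?_ this
    exact sum_nonneg fun i _ => by positivity
  have hlp : ∀ t : ℝ, 0 ≤ t → (t^(1/p-1))^p = t^(1-p) := by
    intro t ht
    rw [← Real.rpow_mul ht]; congr 1; field_simp
  have key := h s (fun i => ((‖T (x i)‖^(1/p-1) : ℝ) : ℂ) • x i) (B^p * S^(1-p)) (by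
    intro φ hφ
    have e : ∀ i ∈ s, ‖φ (((‖T (x i)‖^(1/p-1) : ℝ) : ℂ) • x i)‖^p = ‖φ (x i)‖^p * ‖T (x i)‖^(1-p) := by
      intro i _
      rw [map_smul, norm_smul, Complex.norm_real, Real.norm_of_nonneg (by positivity),
        Real.mul_rpow (by positivity) (by positivity), hlp _ (norm_nonneg _), mul_comm]
    rw [sum_congr rfl e]
    have := Real.inner_le_Lp_mul_Lq_of_nonneg s (p := 1/p) (q := 1/(1-p)) (f := fun i => ‖φ (x i)‖^p)
      (g := fun i => ‖T (x i)‖^(1-p)) (by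
        rw [Real.holderConjugate_iff]; constructor
        · rw [lt_div_iff₀ hp]; linarith
        · simp) (fun i _ => by positivity) (fun i _ => by positivity)
    refine this.trans ?_
    have a1 : ∀ i ∈ s, (‖φ (x i)‖^p)^(1/p) = ‖φ (x i)‖ := by
      intro i _; rw [← Real.rpow_mul (norm_nonneg _), mul_one_div_cancel hp.ne', Real.rpow_one]
    have a2 : ∀ i ∈ s, (‖T (x i)‖^(1-p))^(1/(1-p)) = ‖T (x i)‖ := by
      intro i _; rw [← Real.rpow_mul (norm_nonneg _), mul_one_div_cancel (by linarith), Real.rpow_one]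
    rw [sum_congr rfl a1, sum_congr rfl a2]
    simp only [one_div_one_div]
    gcongr
    exact hB φ hφ)
  have e : ∀ i ∈ s, ‖T (((‖T (x i)‖^(1/p-1) : ℝ) : ℂ) • x i)‖^p = ‖T (x i)‖ := by
    intro i _
    rw [map_smul, norm_smul, Complex.norm_real, Real.norm_of_nonneg (by positivity),
        Real.mul_rpow (by positivity) (by positivity), hlp _ (norm_nonneg _), ← Real.rpow_add_of_nonneg (norm_nonneg _) (by linarith) hp.le]
    simp
  rw [sum_congr rfl e, ← hSd] at key
  rcases hS.eq_or_lt with h0 | h0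
  · rw [← h0]; positivity
  · have : S^p ≤ C * B^p := by
      have h5 : S = S^p * S^(1-p) := by rw [← Real.rpow_add h0]; simp
      rw [← mul_assoc] at key
      nth_rewrite 1 [h5] at key
      exact le_of_mul_le_mul_right key (by positivity)
    have h4 := Real.rpow_le_rpow (by positivity) this (z := 1/p) (by positivity)
    rwa [← Real.rpow_mul hS, mul_one_div_cancel hp.ne', Real.rpow_one, Real.mul_rpow hC (by positivity),
      ← Real.rpow_mul hB0, mul_one_div_cancel hp.ne', Real.rpow_one] at h4
end PS

set_option linter.unusedSectionVars false
namespace PS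
open Finset

section QSsec
variable {A : Type*} [CStarAlgebra A] [PartialOrder A] [StarOrderedRing A]

variable (A) in
def QS : Set (WeakDual ℝ A) := {ρ | (∀ a : A, |ρ a| ≤ ‖a‖) ∧ ∀ a : A, 0 ≤ a → 0 ≤ ρ a}

instance : CompactSpace (QS A) := by
  rw [← isCompact_iff_compactSpace]
  have hcl : IsClosed (QS A) := by
    have : QS A = (⋂ a : A, {ρ | |ρ a| ≤ ‖a‖}) ∩ ⋂ a : A, ⋂ (_ : 0 ≤ a), {ρ | 0 ≤ ρ a} := by
      ext ρ; simp [QS]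
    rw [this]
    refine IsClosed.inter (isClosed_iInter fun a => ?_) (isClosed_iInter fun a => isClosed_iInter fun _ => ?_)
    · exact isClosed_le (continuous_abs.comp (WeakDual.eval_continuous a)) continuous_const
    · exact isClosed_le continuous_const (WeakDual.eval_continuous a)
  refine (WeakDual.isCompact_closedBall (𝕜 := ℝ) (E := A) 0 1).of_isClosed_subset hcl ?_
  intro ρ hρ
  simp only [Set.mem_preimage, Metric.mem_closedBall, dist_zero_right]
  exact ContinuousLinearMap.opNorm_le_bound _ zero_le_one (fun a => by simpa using hρ.1 a)

noncomputable instance : Inhabited (QS A) := ⟨⟨0, by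
  refine ⟨fun a => ?_, fun a _ => ?_⟩
  · change |(0:ℝ)| ≤ ‖a‖
    simp
  · exact le_refl (0:ℝ)⟩⟩

lemma qs_norming (x : A) (hx : IsSelfAdjoint x) : ∃ ρ : QS A, |ρ.1 x| = ‖x‖ := by
  rcases eq_or_ne x 0 with rfl | hx0
  · exact ⟨default, by simp⟩
  have : Nontrivial A := ⟨⟨x, 0, hx0⟩⟩
  have main : ∀ y : A, IsSelfAdjoint y → ‖y‖ ∈ spectrum ℝ y → ∃ ρ : QS A, ρ.1 y = ‖y‖ := by
    intro y hy hs
    have h1 : ‖y‖ + ‖y‖ ∈ spectrum ℝ (algebraMap ℝ A ‖y‖ + y) := by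
      rw [add_comm (algebraMap ℝ A ‖y‖), ← spectrum.add_singleton_eq]
      exact Set.add_mem_add hs rfl
    have h2 := spectrum.norm_le_norm_of_mem h1
    rw [Real.norm_of_nonneg (by positivity)] at h2
    obtain ⟨g, hg1, hg2⟩ := exists_dual_vector'' ℝ (algebraMap ℝ A ‖y‖ + y)
    have hga : ∀ a, |g a| ≤ ‖a‖ := fun a => by
      have := g.le_opNorm a
      rw [Real.norm_eq_abs] at this
      nlinarith [norm_nonneg a]
    have hgl : ∀ r : ℝ, g (algebraMap ℝ A r) = r * g 1 := by
      intro r; rw [Algebra.algebraMap_eq_smul_one, map_smul, smul_eq_mul]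
    have hg3 : g 1 ≤ 1 := by simpa using (abs_le.1 (hga 1)).2
    have hg4 : g y ≤ ‖y‖ := (abs_le.1 (hga y)).2
    rw [map_add, hgl] at hg2
    simp only [RCLike.ofReal_real_eq_id, id] at hg2
    have hy0 : 0 ≤ ‖y‖ := norm_nonneg y
    have hg5 : g y = ‖y‖ := by nlinarith
    rcases hy0.eq_or_lt with h0 | h0
    · have : y = 0 := norm_eq_zero.1 h0.symm
      exact ⟨default, by simp [this]⟩
    have hg6 : g 1 = 1 := by
      have : ‖y‖*1 ≤ ‖y‖ * g 1 := by linarith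
      have := le_of_mul_le_mul_left this h0
      linarith
    refine ⟨⟨StrongDual.toWeakDual g, ⟨hga, fun a ha => ?_⟩⟩, hg5⟩
    have hsa : IsSelfAdjoint a := IsSelfAdjoint.of_nonneg ha
    have l1 : a ≤ algebraMap ℝ A ‖a‖ := hsa.le_algebraMap_norm_self
    have l2 := CStarAlgebra.norm_le_norm_of_nonneg_of_le (a := algebraMap ℝ A ‖a‖ - a) (b := algebraMap ℝ A ‖a‖)
      (sub_nonneg.2 l1) (sub_le_self _ ha)
    rw [norm_algebraMap', norm_norm] at l2
    have l3 := (abs_le.1 (hga (algebraMap ℝ A ‖a‖ - a))).2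
    rw [map_sub, hgl, hg6] at l3
    change 0 ≤ g a
    linarith
  rcases CStarAlgebra.norm_or_neg_norm_mem_spectrum hx with h | h
  · obtain ⟨ρ, hρ⟩ := main x hx h
    exact ⟨ρ, by rw [hρ]; simp⟩
  · obtain ⟨ρ, hρ⟩ := main (-x) hx.neg (by rw [← spectrum.neg_eq]; simpa using h)
    exact ⟨ρ, by rw [← abs_neg, ← map_neg, hρ]; simp⟩

lemma qs_sum {ι : Type*} (s : Finset ι) (x : ι → A) (hx : ∀ i, IsSelfAdjoint (x i)) (B : ℝ)
    (hB : ∀ ρ : QS A, ∑ i ∈ s, |ρ.1 (x i)| ≤ B) (φ : StrongDual ℂ A) (hφ : ‖φ‖ ≤ 1) :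
    ∑ i ∈ s, ‖φ (x i)‖ ≤ 2 * B := by
  have main : ∀ ψ : A →ₗ[ℝ] ℝ, (∀ a, ψ a ≤ ‖a‖) → ∑ i ∈ s, |ψ (x i)| ≤ B := by
    intro ψ hψ
    have e : ∀ i ∈ s, |ψ (x i)| = ψ ((SignType.sign (ψ (x i)) : ℝ) • x i) := by
      intro i _
      rw [map_smul, smul_eq_mul, sign_mul_self]
    rw [sum_congr rfl e, ← map_sum]
    refine (hψ _).trans ?_
    obtain ⟨ρ, hρ⟩ := qs_norming (∑ i ∈ s, (SignType.sign (ψ (x i)) : ℝ) • x i)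
      (isSelfAdjoint_sum s fun i _ => (IsSelfAdjoint.all _).smul (hx i))
    rw [← hρ]
    refine le_trans ?_ (hB ρ)
    rw [map_sum]
    refine (abs_sum_le_sum_abs _ _).trans (sum_le_sum fun i _ => ?_)
    rw [map_smul, smul_eq_mul, abs_mul]
    have : |(SignType.sign (ψ (x i)) : ℝ)| ≤ 1 := by
      rcases lt_trichotomy (ψ (x i)) 0 with h | h | h <;> simp [h]
    nlinarith [abs_nonneg (ρ.1 (x i))]
  have hn : ∀ a, ‖φ a‖ ≤ ‖a‖ := fun a => by
    have := φ.le_opNorm a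
    nlinarith [norm_nonneg a]
  have h1 := main (Complex.reLm ∘ₗ (φ : A →ₗ[ℂ] ℂ).restrictScalars ℝ)
    (fun a => (Complex.re_le_norm _).trans (hn a))
  have h2 := main (Complex.imLm ∘ₗ (φ : A →ₗ[ℂ] ℂ).restrictScalars ℝ)
    (fun a => (Complex.im_le_norm _).trans (hn a))
  calc _ ≤ ∑ i ∈ s, (|(φ (x i)).re| + |(φ (x i)).im|) :=
        sum_le_sum fun i _ => Complex.norm_le_abs_re_add_abs_im _
    _ ≤ 2 * B := by
      rw [sum_add_distrib]
      have h1' : ∑ i ∈ s, |(φ (x i)).re| ≤ B := h1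
      have h2' : ∑ i ∈ s, |(φ (x i)).im| ≤ B := h2
      linarith

/-- evaluation -/
noncomputable def hat : A →ₗ[ℝ] C(QS A, ℝ) where
  toFun a := ⟨fun ρ => ρ.1 a, (WeakDual.eval_continuous a).comp continuous_subtype_val⟩
  map_add' a b := by ext; simp
  map_smul' a b := by ext; simp

@[simp] lemma hat_apply (a : A) (ρ : QS A) : hat a ρ = ρ.1 a := rfl

lemma hat_nonneg (a : A) (ha : 0 ≤ a) : 0 ≤ hat a := fun ρ => ρ.2.2 a ha

lemma hat_mono {a b : A} (h : a ≤ b) : hat a ≤ hat b := by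
  have := hat_nonneg (b-a) (sub_nonneg.2 h)
  rw [map_sub] at this
  exact sub_nonneg.1 this

lemma qs_cs (ρ : QS A) (a b : A) (τ : ℝ) (hτ : 0 < τ) :
    |ρ.1 (star a * b + star b * a)| ≤ ρ.1 (star a * a)/τ + τ * ρ.1 (star b * b) := by
  have h : ∀ r : ℝ, 0 ≤ ρ.1 (star a * a) + r * ρ.1 (star a * b + star b * a) + r^2 * ρ.1 (star b * b) := by
    intro r
    have := ρ.2.2 _ (star_mul_self_nonneg (a + r • b))
    have e : star (a + r • b) * (a + r • b) = star a * a + r • (star a * b + star b * a) + r^2 • (star b * b) := by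
      simp only [star_add, star_smul, star_trivial, add_mul, mul_add, smul_mul_assoc, mul_smul_comm, smul_add, smul_smul]
      rw [sq]; abel
    rw [e] at this
    simpa only [map_add, map_smul, smul_eq_mul] using this
  have h1 := h τ
  have h2 := h (-τ)
  have e : ρ.1 (star a * a)/τ + τ * ρ.1 (star b * b) = (ρ.1 (star a * a) + τ^2 * ρ.1 (star b * b))/τ := by
    field_simp
  rw [e, le_div_iff₀ hτ, ← abs_of_pos hτ, ← abs_mul, abs_of_pos hτ, abs_le]
  constructor <;> linarith

lemma hat_sq (u : A) (hu : IsSelfAdjoint u) : hat u * hat u ≤ hat (u*u) := by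
  intro ρ
  change ρ.1 u * ρ.1 u ≤ ρ.1 (u*u)
  have h : ∀ r : ℝ, 0 ≤ ρ.1 1 * (r*r) + (2 * ρ.1 u) * r + ρ.1 (u*u) := by
    intro r
    have := ρ.2.2 _ (star_mul_self_nonneg (u + r • 1))
    have e : star (u + r • (1:A)) * (u + r • 1) = u * u + (2*r) • u + r^2 • (1:A) := by
      simp only [star_add, star_smul, star_trivial, star_one, hu.star_eq, add_mul, mul_add, smul_mul_assoc, mul_smul_comm, mul_one, one_mul, smul_add, smul_smul]
      rw [sq, two_mul, add_smul]; abel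
    rw [e] at this
    simp only [map_add, map_smul, smul_eq_mul] at this
    linarith
  have h1 := quad_le h
  have h2 : ρ.1 1 ≤ 1 := by
    have := (abs_le.1 (ρ.2.1 1)).2
    refine this.trans ?_
    rcases subsingleton_or_nontrivial A with h | h
    · simp [Subsingleton.elim (1:A) 0]
    · simp
  have h3 : 0 ≤ ρ.1 (u*u) := by
    have := h 0; simpa using this
  nlinarith

lemma hat_norm_le (a : A) : ‖hat a‖ ≤ ‖a‖ := by
  rw [ContinuousMap.norm_le _ (norm_nonneg a)]
  intro ρ; exact ρ.2.1 a

end QSsec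
end PS

namespace PS
open Finset

section CKsec
variable {K : Type*} [TopologicalSpace K] [CompactSpace K]

lemma pietsch [Nonempty K] {V : Type*} [AddCommGroup V] [Module ℝ V] (t : V → ℝ) (v : V → C(K,ℝ))
    (ht : ∀ (r : ℝ) x, 0 ≤ r → t (r • x) = r * t x) (hv : ∀ (r : ℝ) x, 0 ≤ r → v (r • x) = r • v x)
    (h : ∀ (l : List V) (B : ℝ), (∀ ρ, (l.map fun x => v x ρ).sum ≤ B) → (l.map t).sum ≤ B) :
    ∃ m : C(K,ℝ) →ₗ[ℝ] ℝ, (∀ g, 0 ≤ g → 0 ≤ m g) ∧ m 1 = 1 ∧ ∀ x, t x ≤ m (v x) := by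
  set O : Set C(K,ℝ) := {g | ∀ ρ, 0 < g ρ} with hO
  set G : V → C(K,ℝ) := fun x => t x • 1 - v x with hG
  have hGs : ∀ (r : ℝ) x, 0 ≤ r → G (r • x) = r • G x := by
    intro r x hr
    simp only [hG, ht r x hr, hv r x hr, smul_sub, smul_smul]
  set Q : Set C(K,ℝ) := {q | ∃ l : List V, q = (l.map G).sum} with hQ
  have hQadd : ∀ a ∈ Q, ∀ b ∈ Q, a + b ∈ Q := by
    rintro _ ⟨l, rfl⟩ _ ⟨l', rfl⟩
    exact ⟨l ++ l', by simp⟩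
  have hQsm : ∀ a ∈ Q, ∀ r : ℝ, 0 ≤ r → r • a ∈ Q := by
    rintro _ ⟨l, rfl⟩ r hr
    refine ⟨l.map (fun x => r • x), ?_⟩
    rw [List.map_map, List.smul_sum, List.map_map]
    congr 1
    apply List.map_congr_left
    intro x _
    simp [hGs r x hr]
  have hQc : Convex ℝ Q := by
    intro a ha b hb r s hr hs _
    exact hQadd _ (hQsm a ha r hr) _ (hQsm b hb s hs)
  have hOc : Convex ℝ O := by
    intro a ha b hb r s hr hs hrs ρ
    simp only [ContinuousMap.add_apply, ContinuousMap.smul_apply, smul_eq_mul]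
    have h1 := ha ρ
    have h2 := hb ρ
    rcases hr.eq_or_lt with h' | h'
    · have : s = 1 := by linarith
      rw [← h', this]; linarith
    · have := mul_pos h' h1
      have := mul_nonneg hs h2.le
      linarith
  have hOo : IsOpen O := by
    have := ContinuousMap.isOpen_setOfPred_mapsTo (X := K) (Y := ℝ) isCompact_univ (isOpen_Ioi (a := (0:ℝ)))
    convert this using 1
    ext g; simp [hO, Set.MapsTo]
  have hdis : Disjoint O Q := by
    rw [Set.disjoint_left]
    rintro _ hg ⟨l, rfl⟩
    have ev : ∀ ρ, ((l.map G).sum) ρ = (l.map t).sum - (l.map fun x => v x ρ).sum := by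
      intro ρ
      clear hg
      induction l with
      | nil => simp
      | cons a l ih =>
        have hGa : G a ρ = t a - v a ρ := by simp [hG]
        rw [List.map_cons, List.sum_cons, ContinuousMap.add_apply, ih, hGa]
        simp only [List.map_cons, List.sum_cons]
        ring
    have hcont : Continuous fun ρ => (l.map fun x => v x ρ).sum := by
      have : (fun ρ => (l.map fun x => v x ρ).sum) = fun ρ => (l.map t).sum - ((l.map G).sum) ρ := by
        ext ρ; rw [ev]; ring
      rw [this]; fun_prop
    obtain ⟨ρ0, -, hm⟩ := isCompact_univ.exists_isMaxOn (Set.univ_nonempty (α := K)) hcont.continuousOn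
    have := h l _ (fun ρ => hm (Set.mem_univ ρ))
    have h2 := hg ρ0
    rw [ev] at h2
    simp only at this
    linarith
  obtain ⟨F, u, hF1, hF2⟩ := geometric_hahn_banach_open hOc hOo hQc hdis
  have hu : u ≤ 0 := by simpa using hF2 0 ⟨[], by simp⟩
  have h1O : (1 : C(K,ℝ)) ∈ O := fun ρ => by simp
  have hF1' : F 1 < 0 := lt_of_lt_of_le (hF1 1 h1O) hu
  have hFO : ∀ g ∈ O, F g < 0 := fun g hg => lt_of_lt_of_le (hF1 g hg) hu
  have hFQ : ∀ q ∈ Q, 0 ≤ F q := by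
    intro q hq
    by_contra hc
    push Not at hc
    have := hF2 _ (hQsm q hq ((u - 1)/F q) (div_nonneg_of_nonpos (by linarith) hc.le))
    rw [map_smul, smul_eq_mul, div_mul_cancel₀ _ hc.ne] at this
    linarith
  have hFp : ∀ g : C(K,ℝ), 0 ≤ g → F g ≤ 0 := by
    intro g hg
    by_contra hc
    push Not at hc
    have hε : 0 < F g / (-F 1) := div_pos hc (by linarith)
    have := hFO (g + (F g / (-F 1)) • 1) (fun ρ => by
      have : 0 ≤ g ρ := hg ρ
      simp only [ContinuousMap.add_apply, ContinuousMap.smul_apply, ContinuousMap.one_apply, smul_eq_mul, mul_one]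
      linarith)
    rw [map_add, map_smul, smul_eq_mul, div_neg, neg_mul, div_mul_cancel₀ _ hF1'.ne] at this
    linarith
  refine ⟨(F 1)⁻¹ • (F : C(K,ℝ) →ₗ[ℝ] ℝ), fun g hg => ?_, ?_, fun x => ?_⟩
  · simp only [LinearMap.smul_apply, ContinuousLinearMap.coe_coe, smul_eq_mul]
    exact mul_nonneg_of_nonpos_of_nonpos (inv_nonpos.2 hF1'.le) (hFp g hg)
  · simp [hF1'.ne]
  · have := hFQ (G x) ⟨[x], by simp⟩
    simp only [hG, map_sub, map_smul, smul_eq_mul] at this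
    simp only [LinearMap.smul_apply, ContinuousLinearMap.coe_coe, smul_eq_mul]
    rw [inv_mul_eq_div, le_div_iff_of_neg hF1']
    linarith


lemma m_mono (m : C(K,ℝ) →ₗ[ℝ] ℝ) (hm : ∀ g, 0 ≤ g → 0 ≤ m g)
    {g h : C(K,ℝ)} (hgh : g ≤ h) : m g ≤ m h := by
  have := hm (h-g) (sub_nonneg.2 hgh)
  rw [map_sub] at this; linarith

lemma m_abs (m : C(K,ℝ) →ₗ[ℝ] ℝ) (hm : ∀ g, 0 ≤ g → 0 ≤ m g)
    (g : C(K,ℝ)) : |m g| ≤ m |g| := by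
  rw [abs_le]
  constructor
  · rw [← map_neg]
    exact m_mono m hm (neg_le.1 (neg_le_abs g))
  · exact m_mono m hm (le_abs_self g)

lemma hb_ext (m : C(K,ℝ) →ₗ[ℝ] ℝ) (hm : ∀ g, 0 ≤ g → 0 ≤ m g)
    {V : Type*} [AddCommGroup V] [Module ℝ V] (i : V →ₗ[ℝ] C(K,ℝ)) (z : V →ₗ[ℝ] ℝ)
    (hz : ∀ x, |z x| ≤ m |i x|) :
    ∃ l : C(K,ℝ) →ₗ[ℝ] ℝ, (∀ x, l (i x) = z x) ∧ ∀ g, |l g| ≤ m |g| := by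
  have hk : LinearMap.ker i ≤ LinearMap.ker z := by
    intro x hx
    have := hz x
    rw [LinearMap.mem_ker] at hx ⊢
    rw [hx] at this
    simpa using this
  set z' : LinearMap.range i →ₗ[ℝ] ℝ := ((LinearMap.ker i).liftQ z hk) ∘ₗ (i.quotKerEquivRange.symm : LinearMap.range i →ₗ[ℝ] _) with hz'
  have hz'' : ∀ x, z' ⟨i x, LinearMap.mem_range_self i x⟩ = z x := by
    intro x
    simp only [hz', LinearMap.comp_apply, LinearEquiv.coe_coe]
    rw [LinearMap.quotKerEquivRange_symm_apply_image i x]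
    simp
  obtain ⟨l, hl1, hl2⟩ := exists_extension_of_le_sublinear (⟨LinearMap.range i, z'⟩ : C(K,ℝ) →ₗ.[ℝ] ℝ)
    (fun g => m |g|) (fun c hc g => by
      have : |c • g| = c • |g| := by
        ext ρ; simp [abs_mul, abs_of_pos hc]
      rw [this, map_smul, smul_eq_mul])
    (fun g h => by
      rw [← map_add]
      exact m_mono m hm (abs_add_le g h))
    (by
      rintro ⟨_, ⟨x, rfl⟩⟩
      have := hz'' x
      change z' ⟨i x, _⟩ ≤ m |i x|
      rw [this]
      exact (le_abs_self _).trans (hz x))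
  refine ⟨l, fun x => ?_, fun g => ?_⟩
  · rw [← hz'']
    exact hl1 ⟨i x, LinearMap.mem_range_self i x⟩
  · rw [abs_le]
    refine ⟨?_, hl2 g⟩
    have := hl2 (-g)
    rw [map_neg, abs_neg] at this
    linarith

lemma sakai_ck (m : C(K,ℝ) →ₗ[ℝ] ℝ) (hm : ∀ g, 0 ≤ g → 0 ≤ m g)
    (l : C(K,ℝ) →ₗ[ℝ] ℝ) (hl : ∀ g, |l g| ≤ m |g|) (η : ℝ) (hη : 0 < η) :
    ∃ h : C(K,ℝ), (∀ ρ, |h ρ| ≤ 1) ∧ ∀ g, |l g - m (h*g)| ≤ η * Real.sqrt (m (g*g)) := by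
  set b : C(K,ℝ) →ₗ[ℝ] C(K,ℝ) →ₗ[ℝ] ℝ := (LinearMap.mul ℝ C(K,ℝ)).compr₂ m with hb
  have hbe : ∀ g h, b g h = m (g*h) := fun g h => rfl
  have hs : ∀ g h, b g h = b h g := fun g h => by rw [hbe, hbe, mul_comm]
  have hp : ∀ g, 0 ≤ b g g := fun g => hm _ (fun ρ => mul_self_nonneg (g ρ))
  have hm1 : 0 ≤ m 1 := hm 1 (fun ρ => zero_le_one)
  obtain ⟨h, hh1, hh2⟩ := sakai b hs hp {c | ∀ ρ, |c ρ| ≤ 1}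
    (by
      intro a ha c hc r s hr hs hrs ρ
      simp only [ContinuousMap.add_apply, ContinuousMap.smul_apply, smul_eq_mul]
      have h1 := ha ρ
      have h2 := hc ρ
      calc _ ≤ |r * a ρ| + |s * c ρ| := abs_add_le _ _
        _ ≤ r * 1 + s * 1 := by
          rw [abs_mul, abs_mul, abs_of_nonneg hr, abs_of_nonneg hs]; gcongr
        _ = 1 := by linarith)
    ⟨0, fun ρ => by simp⟩ (4 * m 1)
    (by
      intro v hv x hx
      rw [hbe, ← smul_eq_mul (4:ℝ), ← map_smul]
      apply m_mono m hm
      intro ρ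
      change (v ρ - x ρ) * (v ρ - x ρ) ≤ 4 * 1
      have h1 := abs_le.1 (hv ρ)
      have h2 := abs_le.1 (hx ρ)
      nlinarith)
    l (m 1)
    (by
      intro u
      have h1 := bcs b hs hp |u| 1
      have habs : |u| * |u| = u * u := by
        ext ρ; exact abs_mul_abs_self (u ρ)
      rw [hbe, hbe, hbe, mul_one, mul_one, habs] at h1
      have h2 : |l u| ≤ Real.sqrt (m (u*u)) * Real.sqrt (m 1) := (hl u).trans ((le_abs_self _).trans h1)
      have h3 : |l u|^2 ≤ (Real.sqrt (m (u*u)) * Real.sqrt (m 1))^2 := by gcongr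
      rw [sq_abs, mul_pow, Real.sq_sqrt hm1, Real.sq_sqrt (show 0 ≤ m (u*u) from hp u)] at h3
      rw [hbe]; linarith)
    (by
      intro u ε hε
      set e := ε/(m 1 + 1) with he
      have he0 : 0 < e := by positivity
      have hpos : ∀ ρ, 0 < |u ρ| + e := fun ρ => by positivity
      set v : C(K,ℝ) := ⟨fun ρ => u ρ / (|u ρ| + e), by
        apply Continuous.div (by fun_prop) (by fun_prop)
        intro ρ; exact (hpos ρ).ne'⟩ with hv
      refine ⟨v, fun ρ => ?_, ?_⟩
      · change |u ρ / (|u ρ| + e)| ≤ 1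
        rw [abs_div, abs_of_pos (hpos ρ), div_le_one (hpos ρ)]; linarith
      · have h1 : |u| - e • 1 ≤ v * u := by
          intro ρ
          change |u ρ| - e * 1 ≤ u ρ / (|u ρ| + e) * u ρ
          rw [div_mul_eq_mul_div (u ρ), le_div_iff₀ (hpos ρ), ← abs_mul_abs_self (u ρ)]
          nlinarith
        have h2 := m_mono m hm h1
        rw [map_sub, map_smul, smul_eq_mul] at h2
        rw [hbe]
        have h3 := (abs_le.1 (hl u)).2
        have h4 : e * m 1 ≤ ε := by
          rw [he, div_mul_eq_mul_div, div_le_iff₀ (by positivity)]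
          nlinarith
        linarith)
    η hη
  exact ⟨h, hh1, fun g => hh2 g⟩

end CKsec
end PS

namespace PS
open Finset

section CSsec
variable {A : Type*} [CStarAlgebra A] [PartialOrder A] [StarOrderedRing A]

lemma sq_le_norm (a : A) (ha : IsSelfAdjoint a) (c : ℝ) (hc : ‖a‖ ≤ c) : a * a ≤ (c^2) • (1:A) := by
  have h := CStarAlgebra.star_mul_le_algebraMap_norm_sq (a := a)
  rw [ha.star_eq] at h
  refine h.trans ?_
  rw [← Algebra.algebraMap_eq_smul_one]
  exact algebraMap_mono A (by gcongr)

lemma norm_le_one' {a : A} (h0 : 0 ≤ a) (h1 : a ≤ 1) : ‖a‖ ≤ 1 := by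
  rcases subsingleton_or_nontrivial A with h | h
  · simp [Subsingleton.elim a 0]
  · simpa using CStarAlgebra.norm_le_norm_of_nonneg_of_le h0 h1

lemma sakai_cstar (f : A →ₗ[ℝ] ℝ) (hf : ∀ a, 0 ≤ a → 0 ≤ f a)
    (z : A →ₗ[ℝ] ℝ) (Kz : ℝ) (hz : ∀ u, IsSelfAdjoint u → z u ^2 ≤ Kz * f (u*u))
    (hzp : ∀ u v : A, IsSelfAdjoint u → 0 ≤ v → u ≤ v → z u ≤ f v) (η : ℝ) (hη : 0 < η) :
    ∃ x : A, 0 ≤ x ∧ x ≤ 1 ∧ ∀ u, IsSelfAdjoint u → |z u - f (x*u+u*x)/2| ≤ η * Real.sqrt (f (u*u)) := by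
  let V := selfAdjoint.submodule ℝ A
  have hV : ∀ u : V, IsSelfAdjoint (u : A) := fun u => u.2
  have fmono : ∀ a b : A, a ≤ b → f a ≤ f b := fun a b h => by
    have := hf _ (sub_nonneg.2 h); rw [map_sub] at this; linarith
  have hf1 : 0 ≤ f 1 := hf 1 zero_le_one
  let b : V →ₗ[ℝ] V →ₗ[ℝ] ℝ := LinearMap.mk₂ ℝ (fun x y : V => f ((x:A)*y+y*x)/2)
    (by intro x y z; simp only [Submodule.coe_add, add_mul, mul_add, map_add]; ring)
    (by intro c x y; simp only [Submodule.coe_smul, smul_mul_assoc, mul_smul_comm, ← smul_add, map_smul, smul_eq_mul]; ring)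
    (by intro x y z; simp only [Submodule.coe_add, add_mul, mul_add, map_add]; ring)
    (by intro c x y; simp only [Submodule.coe_smul, smul_mul_assoc, mul_smul_comm, ← smul_add, map_smul, smul_eq_mul]; ring)
  have hbe : ∀ x y : V, b x y = f ((x:A)*y+y*x)/2 := fun x y => rfl
  have hbs : ∀ x : V, b x x = f ((x:A)*x) := fun x => by rw [hbe, map_add]; ring
  have hs : ∀ x y, b x y = b y x := fun x y => by rw [hbe, hbe, add_comm]
  have hp : ∀ x, 0 ≤ b x x := fun x => by
    rw [hbs]; apply hf
    have := star_mul_self_nonneg (x:A)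
    rwa [(hV x).star_eq] at this
  obtain ⟨x, ⟨hx0, hx1⟩, hx2⟩ := sakai b hs hp {c | 0 ≤ (c:A) ∧ (c:A) ≤ 1}
    (by
      intro a ha c hc r s hr hs hrs
      constructor
      · exact add_nonneg (smul_nonneg hr ha.1) (smul_nonneg hs hc.1)
      · calc r • (a:A) + s • (c:A) ≤ r • (1:A) + s • (1:A) :=
            add_le_add (smul_le_smul_of_nonneg_left ha.2 hr) (smul_le_smul_of_nonneg_left hc.2 hs)
          _ = 1 := by rw [← add_smul, hrs, one_smul])
    ⟨0, by simp⟩ (2^2 * f 1)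
    (by
      intro v hv x hx
      rw [hbs, ← smul_eq_mul (2^2 : ℝ), ← map_smul]
      apply fmono
      apply sq_le_norm _ (hV _)
      calc ‖(v:A) - (x:A)‖ ≤ ‖(v:A)‖ + ‖(x:A)‖ := norm_sub_le _ _
        _ ≤ 1 + 1 := add_le_add (norm_le_one' hv.1 hv.2) (norm_le_one' hx.1 hx.2)
        _ = 2 := by norm_num)
    (z ∘ₗ V.subtype) Kz (fun u => by rw [hbs]; exact hz u (hV u))
    (by
      intro u ε hε
      set e := ε/(f 1 + 1) with he
      have he0 : 0 < e := by positivity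
      have hu := hV u
      set k : ℝ → ℝ := fun t => max t 0 / (max t 0 + e) with hk
      have hpos : ∀ t : ℝ, 0 < max t 0 + e := fun t => by positivity
      have hkc : Continuous k := by
        apply Continuous.div (by fun_prop) (by fun_prop)
        intro t; exact (hpos t).ne'
      have hk0 : 0 ≤ cfc k (u:A) := cfc_nonneg (fun t _ => by positivity)
      have hk1 : cfc k (u:A) ≤ 1 := cfc_le_one k _ (fun t _ => by
        simp only [hk]; rw [div_le_one (hpos t)]; linarith)
      refine ⟨⟨cfc k (u:A), IsSelfAdjoint.of_nonneg hk0⟩, ⟨hk0, hk1⟩, ?_⟩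
      rw [hbe]
      change z u - ε ≤ f (cfc k (u:A) * u + u * cfc k (u:A))/2
      have e1 : cfc k (u:A) * u = cfc (fun t => k t * t) (u:A) := by
        rw [cfc_mul k (fun t => t) (u:A) hkc.continuousOn continuous_id.continuousOn, cfc_id' ℝ (u:A)]
      have e2 : (u:A) * cfc k (u:A) = cfc (fun t => k t * t) (u:A) := by
        rw [← e1]
        have := (cfc_commute_cfc (fun t : ℝ => t) k (u:A)).eq
        rwa [cfc_id' ℝ (u:A)] at this
      set P := cfc (fun t : ℝ => max t 0) (u:A) with hP
      have hP0 : 0 ≤ P := cfc_nonneg (fun t _ => le_max_right _ _)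
      have huP : (u:A) ≤ P := by
        conv_lhs => rw [← cfc_id' ℝ (u:A)]
        exact cfc_mono (fun t _ => le_max_left _ _)
      have h1 : P - e • 1 ≤ cfc (fun t => k t * t) (u:A) := by
        rw [← Algebra.algebraMap_eq_smul_one, ← cfc_const e (u:A), hP, ← cfc_sub _ _ (u:A)]
        apply cfc_mono
        · intro t _
          simp only [hk]
          rw [div_mul_eq_mul_div (max t 0), le_div_iff₀ (hpos t)]
          rcases le_total t 0 with h | h
          · rw [max_eq_right h]; nlinarith
          · rw [max_eq_left h]; nlinarith
        · show ContinuousOn (fun t : ℝ => max t 0 - e) _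
          fun_prop
        · exact (hkc.mul continuous_id).continuousOn
      have h2 := fmono _ _ h1
      rw [map_sub, map_smul, smul_eq_mul] at h2
      have h3 := hzp u P hu hP0 huP
      rw [e2, e1, map_add]
      have h4 : e * f 1 ≤ ε := by
        rw [he, div_mul_eq_mul_div, div_le_iff₀ (by positivity)]
        nlinarith
      linarith)
    η hη
  refine ⟨x, hx0, hx1, fun u hu => ?_⟩
  have := hx2 ⟨u, hu⟩
  rw [hbs, hbe] at this
  exact this

lemma normalise (N : ℕ) (x : ℕ → A) (hx0 : ∀ n, 0 ≤ x n) (hx1 : ∀ n, x n ≤ 1) :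
    ∃ x' : ℕ → A, (∀ n, 0 ≤ x' n) ∧ ∑ n ∈ range N, x' n ≤ 1 ∧
      ∀ n, ∀ τ : ℝ, 0 < τ → |hat (x' n) - hat (x n)| ≤
        (1+1/τ) • hat ((∑ n ∈ range N, x n - 1) * (∑ n ∈ range N, x n - 1)) + τ • 1 := by
  set y := ∑ n ∈ range N, x n with hy
  have hy0 : 0 ≤ y := sum_nonneg fun n _ => hx0 n
  have hysa : IsSelfAdjoint y := IsSelfAdjoint.of_nonneg hy0
  set k : ℝ → ℝ := fun t => 1 / Real.sqrt (max 1 t) with hk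
  have hmax : ∀ t : ℝ, 1 ≤ Real.sqrt (max 1 t) := fun t => by
    rw [Real.one_le_sqrt]; exact le_max_left _ _
  have hkc : Continuous k := by
    apply Continuous.div (by fun_prop) (by fun_prop)
    intro t; linarith [hmax t]
  set g := cfc k y with hg
  have hgsa : IsSelfAdjoint g := cfc_predicate k y
  set d := g - 1 with hd
  have hdsa : IsSelfAdjoint d := hgsa.sub (IsSelfAdjoint.one A)
  have hdy : d * d ≤ (y-1)*(y-1) := by
    have e1 : d = cfc (fun t => k t - 1) y := by
      rw [hd, hg, cfc_sub k (fun _ => 1) y hkc.continuousOn, cfc_const_one ℝ y]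
    have e2 : y - 1 = cfc (fun t : ℝ => t - 1) y := by
      rw [cfc_sub (fun t : ℝ => t) (fun _ => 1) y, cfc_id' ℝ y, cfc_const_one ℝ y]
    have hkc' : ContinuousOn (fun t => k t - 1) (spectrum ℝ y) := (hkc.sub continuous_const).continuousOn
    rw [e1, e2, ← cfc_mul _ _ y hkc' hkc', ← cfc_mul (fun t : ℝ => t - 1) (fun t : ℝ => t - 1) y (by fun_prop) (by fun_prop)]
    apply cfc_mono
    · intro t _
      simp only [hk]
      rcases le_total t 1 with h | h
      · rw [max_eq_left h]; simp; nlinarith [sq_nonneg (t-1)]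
      · rw [max_eq_right h]
        have h1 := hmax t
        rw [max_eq_right h] at h1
        set s := Real.sqrt t with hs
        have hst : s^2 = t := Real.sq_sqrt (by linarith)
        have h2 : 0 ≤ 1 - 1/s := by
          rw [sub_nonneg, div_le_one (by linarith)]; exact h1
        have h3 : 1 - 1/s ≤ t - 1 := by
          have : 1 - 1/s = (s-1)/s := by field_simp
          rw [this, div_le_iff₀ (by linarith), ← hst]
          have : s^2 - 1 = (s-1)*(s+1) := by ring
          rw [this]
          nlinarith [mul_nonneg (sub_nonneg.2 h1) (sub_nonneg.2 h1)]
        nlinarith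
    · exact hkc'.mul hkc'
    · show ContinuousOn (fun t : ℝ => (t - 1) * (t - 1)) _
      fun_prop
  have hsum : g * y * g ≤ 1 := by
    have e1 : g * y * g = cfc (fun t => k t * t * k t) y := by
      rw [cfc_mul (fun t => k t * t) k y (hkc.mul continuous_id).continuousOn hkc.continuousOn,
        cfc_mul k (fun t => t) y hkc.continuousOn continuous_id.continuousOn, cfc_id' ℝ y]
    rw [e1]
    apply cfc_le_one
    intro t _
    simp only [hk]
    have h1 := hmax t
    have h2 : Real.sqrt (max 1 t)^2 = max 1 t := Real.sq_sqrt (by positivity)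
    have : 1 / √(max 1 t) * t * (1 / √(max 1 t)) = t / (Real.sqrt (max 1 t)^2) := by field_simp
    rw [this, h2, div_le_one (by positivity)]
    exact le_max_right _ _
  refine ⟨fun n => g * x n * g, fun n => ?_, ?_, ?_⟩
  · exact hgsa.conjugate_nonneg (hx0 n)
  · rw [← sum_mul, ← mul_sum]; exact hsum
  · intro n τ hτ ρ
    have e1 : g * x n * g = d * x n * d + (star d * x n + star (x n) * d) + x n := by
      rw [(IsSelfAdjoint.of_nonneg (hx0 n)).star_eq, hdsa.star_eq, hd]
      noncomm_ring
    have h0 := qs_cs ρ d (x n) τ hτ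
    rw [(IsSelfAdjoint.of_nonneg (hx0 n)).star_eq, hdsa.star_eq] at h0
    rw [(IsSelfAdjoint.of_nonneg (hx0 n)).star_eq, hdsa.star_eq] at e1
    change |ρ.1 (g * x n * g) - ρ.1 (x n)| ≤ (1+1/τ) * ρ.1 ((y-1)*(y-1)) + τ * 1
    have ρmono : ∀ a b : A, a ≤ b → ρ.1 a ≤ ρ.1 b := fun a b h => by
      have := ρ.2.2 _ (sub_nonneg.2 h); rw [map_sub] at this; linarith
    have h1 : ρ.1 1 ≤ 1 := (abs_le.1 (ρ.2.1 1)).2.trans (norm_le_one' zero_le_one le_rfl)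
    have h2 : ρ.1 (x n * x n) ≤ 1 := by
      have := ρmono _ _ (sq_le_norm (x n) (IsSelfAdjoint.of_nonneg (hx0 n)) 1 (norm_le_one' (hx0 n) (hx1 n)))
      rw [map_smul] at this
      simp at this; linarith
    have h3 : 0 ≤ ρ.1 (d * x n * d) := ρ.2.2 _ (hdsa.conjugate_nonneg (hx0 n))
    have h4 : ρ.1 (d * x n * d) ≤ ρ.1 (d*d) := by
      have := ρmono _ _ (hdsa.conjugate_le_conjugate (hx1 n))
      rwa [mul_one] at this
    have h5 := ρmono _ _ hdy
    rw [e1, map_add, map_add]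
    have h6 : τ * ρ.1 (x n * x n) ≤ τ * 1 := by gcongr
    have h7 : ρ.1 (d*d)/τ ≤ ρ.1 ((y-1)*(y-1))/τ := by gcongr
    have h8 : (1+1/τ) * ρ.1 ((y-1)*(y-1)) = ρ.1 ((y-1)*(y-1)) + ρ.1 ((y-1)*(y-1))/τ := by ring
    have h0' := abs_le.1 h0
    rw [h8, abs_le]
    constructor <;> linarith
end CSsec
end PS

namespace PS
open Finset

section redlemmas

lemma red_map {V W : Type*} [AddCommGroup V] [AddCommGroup W] (φ : V →+ W) (j : ℕ) :
    ∀ (x : ℕ → V) (s : ℕ), φ (red^[j] x s) = red^[j] (fun n => φ (x n)) s := by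
  induction j with
  | zero => intro x s; rfl
  | succ j ih =>
    intro x s
    rw [Function.iterate_succ_apply, Function.iterate_succ_apply, ih]
    have h : (fun n => φ (red x n)) = red (fun n => φ (x n)) := by
      funext n; simp [red]
    rw [h]

lemma dif_map {V W : Type*} [AddCommGroup V] [AddCommGroup W] (φ : V →+ W) (j : ℕ)
    (x : ℕ → V) (s : ℕ) : φ (dif (red^[j] x) s) = dif (red^[j] (fun n => φ (x n))) s := by
  simp only [dif, map_sub, red_map]

lemma red_sub {V : Type*} [AddCommGroup V] (j : ℕ) :
    ∀ (x y : ℕ → V) (s : ℕ), red^[j] (fun n => x n - y n) s = red^[j] x s - red^[j] y s := by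
  induction j with
  | zero => intro x y s; rfl
  | succ j ih =>
    intro x y s
    rw [Function.iterate_succ_apply, Function.iterate_succ_apply, Function.iterate_succ_apply, ← ih]
    have h : red (fun n => x n - y n) = (fun n => red x n - red y n) := by
      funext n; simp only [red]; abel
    rw [h]

lemma sum_red_iter {V : Type*} [AddCommMonoid V] (x : ℕ → V) (j : ℕ) : ∀ k : ℕ,
    ∑ s ∈ range (2^k), red^[j] x s = ∑ n ∈ range (2^(k+j)), x n := by
  induction j with
  | zero => intro k; rfl
  | succ j ih =>
    intro k
    rw [Function.iterate_succ_apply', sum_red, ih, show k+1+j = k+(j+1) by ring]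

lemma red_mono {V : Type*} [AddCommMonoid V] [PartialOrder V] [IsOrderedAddMonoid V] (j : ℕ) :
    ∀ (x y : ℕ → V) (k s : ℕ), s < 2^k → (∀ n < 2^(k+j), x n ≤ y n) → red^[j] x s ≤ red^[j] y s := by
  induction j with
  | zero => intro x y k s hs h; exact h s hs
  | succ j ih =>
    intro x y k s hs h
    rw [Function.iterate_succ_apply, Function.iterate_succ_apply]
    refine ih _ _ k s hs (fun n hn => ?_)
    have h2 : 2^(k+(j+1)) = 2*2^(k+j) := by ring
    exact add_le_add (h _ (by omega)) (h _ (by omega))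

lemma red_const (c : ℝ) (j : ℕ) : ∀ s, red^[j] (fun _ => c) s = 2^j * c := by
  induction j with
  | zero => intro s; simp
  | succ j ih =>
    intro s
    rw [Function.iterate_succ_apply']
    simp only [red, ih]; ring

lemma red_add {V : Type*} [AddCommGroup V] (j : ℕ) :
    ∀ (x y : ℕ → V) (s : ℕ), red^[j] (fun n => x n + y n) s = red^[j] x s + red^[j] y s := by
  induction j with
  | zero => intro x y s; rfl
  | succ j ih =>
    intro x y s
    rw [Function.iterate_succ_apply, Function.iterate_succ_apply, Function.iterate_succ_apply, ← ih]
    have h : red (fun n => x n + y n) = (fun n => red x n + red y n) := by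
      funext n; simp only [red]; abel
    rw [h]

lemma red_nonneg {V : Type*} [AddCommMonoid V] [PartialOrder V] [IsOrderedAddMonoid V] (j : ℕ) :
    ∀ (x : ℕ → V) (_ : ∀ n, 0 ≤ x n) (s : ℕ), 0 ≤ red^[j] x s := by
  induction j with
  | zero => intro x h s; exact h s
  | succ j ih =>
    intro x h s
    exact ih _ (fun n => add_nonneg (h _) (h _)) s

lemma red_abs_le (j : ℕ) : ∀ (x : ℕ → ℝ) (s : ℕ), |red^[j] x s| ≤ red^[j] (fun n => |x n|) s := by
  induction j with
  | zero => intro x s; exact le_rfl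
  | succ j ih =>
    intro x s
    rw [Function.iterate_succ_apply', Function.iterate_succ_apply']
    exact (abs_add_le _ _).trans (add_le_add (ih _ _) (ih _ _))

/-- total alternating sum at level j -/
def alt {V : Type*} [AddCommGroup V] (k j : ℕ) (x : ℕ → V) : V := ∑ s ∈ range (2^k), dif (red^[j] x) s

lemma alt_map {V W : Type*} [AddCommGroup V] [AddCommGroup W] (φ : V →+ W) (k j : ℕ) (x : ℕ → V) :
    φ (alt k j x) = alt k j (fun n => φ (x n)) := by
  simp only [alt, map_sum, dif_map]

lemma alt_sub {V : Type*} [AddCommGroup V] (k j : ℕ) (x y : ℕ → V) :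
    alt k j (fun n => x n - y n) = alt k j x - alt k j y := by
  simp only [alt, ← sum_sub_distrib]
  refine sum_congr rfl fun s _ => ?_
  simp only [dif, red_sub]; abel

lemma alt_abs_le (k j : ℕ) (x : ℕ → ℝ) : |alt k j x| ≤ ∑ n ∈ range (2^(k+(j+1))), |x n| := by
  rw [← sum_red_iter (fun n => |x n|) (j+1) k]
  refine (abs_sum_le_sum_abs _ _).trans (sum_le_sum fun s _ => ?_)
  rw [Function.iterate_succ_apply']
  exact (abs_sub _ _).trans (add_le_add (red_abs_le _ _ _) (red_abs_le _ _ _))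

end redlemmas

section noncpt
variable {A : Type*} [CStarAlgebra A] {E : Type*} [NormedAddCommGroup E] [NormedSpace ℂ E] [CompleteSpace E]

lemma compact_of_tb (T : A →L[ℂ] E) (h : TotallyBounded (T '' {x : A | IsSelfAdjoint x ∧ ‖x‖ ≤ 1})) :
    IsCompactOperator T := by
  set S := T '' {x : A | IsSelfAdjoint x ∧ ‖x‖ ≤ 1} with hS
  have hK : IsCompact (closure S) := h.closure.isCompact_of_isClosed isClosed_closure
  have hK2 : IsCompact ((fun q : E × E => q.1 + Complex.I • q.2) '' (closure S ×ˢ closure S)) :=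
    (hK.prod hK).image (by fun_prop)
  refine ⟨_, hK2, Filter.mem_of_superset (Metric.closedBall_mem_nhds 0 one_pos) ?_⟩
  intro x hx
  rw [mem_closedBall_zero_iff] at hx
  refine ⟨(T (realPart x : A), T (imaginaryPart x : A)), ⟨subset_closure ⟨_, ⟨(realPart x).2, ?_⟩, rfl⟩,
    subset_closure ⟨_, ⟨(imaginaryPart x).2, ?_⟩, rfl⟩⟩, ?_⟩
  · exact (realPart.norm_le x).trans hx
  · exact (imaginaryPart.norm_le x).trans hx
  · simp only
    rw [← map_smul, ← map_add, realPart_add_I_smul_imaginaryPart]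

lemma noncompact (T : A →L[ℂ] E) (hT : ¬ IsCompactOperator T) :
    ∃ δ > 0, ∃ e : ℕ → StrongDual ℝ E, (∀ n, ‖e n‖ ≤ 1) ∧ ∀ i j, i ≠ j →
      ∃ x : A, IsSelfAdjoint x ∧ ‖x‖ ≤ 1 ∧ δ ≤ (e i - e j) (T x) := by
  by_contra hcon
  push Not at hcon
  apply hT
  apply compact_of_tb
  rw [Metric.totallyBounded_iff]
  intro ε hε
  set δ := ε/4 with hδ
  have hδ0 : 0 < δ := by positivity
  have hfin : ∃ s : Finset (StrongDual ℝ E), (∀ e ∈ s, ‖e‖ ≤ 1) ∧ ∀ y : StrongDual ℝ E, ‖y‖ ≤ 1 →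
      ∃ e ∈ s, ∀ x : A, IsSelfAdjoint x → ‖x‖ ≤ 1 → |(y - e) (T x)| < δ := by
    by_contra hc
    push Not at hc
    have hc' : ∀ s : Finset (StrongDual ℝ E), (∀ e ∈ s, ‖e‖ ≤ 1) → ∃ y : StrongDual ℝ E, ‖y‖ ≤ 1 ∧
      ∀ e ∈ s, ∃ x : A, IsSelfAdjoint x ∧ ‖x‖ ≤ 1 ∧ δ ≤ (e - y) (T x) := by
      intro s hs
      obtain ⟨y, hy, hy2⟩ := hc s hs
      refine ⟨y, hy, fun e he => ?_⟩
      obtain ⟨x, hx, hx1, hx2⟩ := hy2 e he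
      rcases le_abs.1 hx2 with h | h
      · refine ⟨-x, hx.neg, by rwa [norm_neg], ?_⟩
        simp only [sub_apply, map_neg] at h ⊢
        linarith
      · refine ⟨x, hx, hx1, ?_⟩
        simp only [sub_apply] at h ⊢
        linarith
    obtain ⟨e, he1, he2⟩ := exists_seq_of_forall_finset_exists (fun y : StrongDual ℝ E => ‖y‖ ≤ 1)
      (fun e y => ∃ x : A, IsSelfAdjoint x ∧ ‖x‖ ≤ 1 ∧ δ ≤ (e - y) (T x)) hc'
    obtain ⟨i, j, hij, hx⟩ := hcon δ hδ0 e he1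
    rcases lt_or_gt_of_ne hij with h | h
    · obtain ⟨x, h1, h2, h3⟩ := he2 i j h
      exact absurd (hx x h1 h2) (not_lt.2 h3)
    · obtain ⟨x, h1, h2, h3⟩ := he2 j i h
      refine absurd (hx (-x) h1.neg (by rwa [norm_neg])) (not_lt.2 ?_)
      simp only [sub_apply, map_neg] at h3 ⊢
      linarith
  obtain ⟨s, hs1, hs2⟩ := hfin
  set B := {x : A | IsSelfAdjoint x ∧ ‖x‖ ≤ 1} with hB
  set Φ : A → (s → ℝ) := fun x e => e.1 (T x) with hΦ
  have hbd : TotallyBounded (Φ '' B) := by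
    have : Φ '' B ⊆ Metric.closedBall 0 ‖T‖ := by
      rintro _ ⟨x, hx, rfl⟩
      rw [mem_closedBall_zero_iff, pi_norm_le_iff_of_nonneg (norm_nonneg T)]
      intro e
      calc ‖e.1 (T x)‖ ≤ ‖e.1‖ * ‖T x‖ := e.1.le_opNorm _
        _ ≤ 1 * (‖T‖ * 1) := by
          gcongr
          · exact hs1 e.1 e.2
          · exact (T.le_opNorm x).trans (by gcongr; exact hx.2)
        _ = ‖T‖ := by ring
    exact (isCompact_closedBall _ _).totallyBounded.subset this
  obtain ⟨t, ht1, ht2, ht3⟩ := Metric.finite_approx_of_totallyBounded hbd δ hδ0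
  have ht1' : ∀ y ∈ t, ∃ x, x ∈ B ∧ Φ x = y := fun y hy => ht1 hy
  choose! ψ hψ using ht1'
  refine ⟨(fun y => T (ψ y)) '' t, ht2.image _, ?_⟩
  rintro _ ⟨x, hx, rfl⟩
  obtain ⟨y, hy, hxy⟩ := Set.mem_iUnion₂.1 (ht3 ⟨x, hx, rfl⟩)
  refine Set.mem_iUnion₂.2 ⟨_, ⟨y, hy, rfl⟩, ?_⟩
  rw [Metric.mem_ball, dist_eq_norm]
  obtain ⟨g, hg1, hg2⟩ := exists_dual_vector'' ℝ (T x - T (ψ y))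
  obtain ⟨e, he, he2⟩ := hs2 g hg1
  have a1 := abs_lt.1 (he2 x hx.1 hx.2)
  have a2 := abs_lt.1 (he2 (ψ y) (hψ y hy).1.1 (hψ y hy).1.2)
  have a3 : |e (T x) - e (T (ψ y))| < δ := by
    rw [← (hψ y hy).2, Metric.mem_ball] at hxy
    have := (dist_pi_lt_iff hδ0).1 hxy ⟨e, he⟩
    rwa [Real.dist_eq] at this
  have a4 := abs_lt.1 a3
  simp only [sub_apply] at a1 a2
  rw [map_sub] at hg2
  simp only [RCLike.ofReal_real_eq_id, id] at hg2
  rw [← hg2]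
  linarith
end noncpt
end PS

namespace PS
open Finset

section tree
variable {A : Type*} [CStarAlgebra A] [PartialOrder A] [StarOrderedRing A]
  {E : Type*} [NormedAddCommGroup E] [NormedSpace ℂ E]

lemma dom (T : A →L[ℂ] E) {C : ℝ} (h : PSum' 1 T C) :
    ∃ m : C(QS A,ℝ) →ₗ[ℝ] ℝ, (∀ g, 0 ≤ g → 0 ≤ m g) ∧
      ∀ x : A, IsSelfAdjoint x → ‖T x‖ ≤ m |hat x| := by
  obtain ⟨hC, h⟩ := h
  let V := selfAdjoint.submodule ℝ A
  have key : ∃ m : C(QS A,ℝ) →ₗ[ℝ] ℝ, (∀ g, 0 ≤ g → 0 ≤ m g) ∧ m 1 = 1 ∧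
      ∀ x : V, ‖T (x:A)‖ ≤ m ((2*C+1) • |hat (x:A)|) := by
    refine pietsch (K := QS A) (V := V) (fun x => ‖T (x:A)‖)
      (fun x => (2*C+1) • |hat (x:A)|) ?_ ?_ ?_
    · intro r x hr
      have : T ((r • x : V) : A) = r • T (x:A) := by
        rw [Submodule.coe_smul]; exact map_real_smul T.toLinearMap.toAddMonoidHom T.continuous r _
      simp only [this, norm_smul, Real.norm_of_nonneg hr]
    · intro r x hr
      ext ρ
      simp [abs_mul, abs_of_nonneg hr]
      ring
    · intro l B hB
      rw [← Fin.sum_univ_fun_getElem]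
      have hB' : ∀ ρ : QS A, ∑ i : Fin l.length, |ρ.1 ((l[i] : V) : A)| ≤ B/(2*C+1) := by
        intro ρ
        rw [le_div_iff₀ (by positivity), sum_mul]
        have := hB ρ
        rw [← Fin.sum_univ_fun_getElem] at this
        refine le_trans (le_of_eq ?_) this
        refine sum_congr rfl fun i _ => ?_
        simp; ring
      have h2 := h univ (fun i : Fin l.length => ((l[i] : V) : A)) (2 * (B/(2*C+1))) (by
        intro φ hφ
        simp only [Real.rpow_one]
        exact qs_sum univ _ (fun i => (l[i] : V).2) _ hB' φ hφ)
      simp only [Real.rpow_one] at h2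
      refine h2.trans ?_
      have hB0 : 0 ≤ B/(2*C+1) := le_trans (sum_nonneg fun i _ => abs_nonneg _) (hB' default)
      have : B = (2*C+1) * (B/(2*C+1)) := by field_simp
      nlinarith
  obtain ⟨m, hm, -, hm2⟩ := key
  refine ⟨(2*C+1) • m, fun g hg => ?_, fun x hx => ?_⟩
  · have := hm g hg
    simp only [LinearMap.smul_apply, smul_eq_mul]; positivity
  · have := hm2 ⟨x, hx⟩
    simpa using this


lemma step6 (m : C(QS A,ℝ) →ₗ[ℝ] ℝ) (hm : ∀ g, 0 ≤ g → 0 ≤ m g) (T : A →L[ℂ] E)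
    (hT : ∀ x : A, IsSelfAdjoint x → ‖T x‖ ≤ m |hat x|)
    (δ : ℝ) (e : ℕ → StrongDual ℝ E) (he1 : ∀ n, ‖e n‖ ≤ 1)
    (he2 : ∀ i j, i ≠ j → ∃ x : A, IsSelfAdjoint x ∧ ‖x‖ ≤ 1 ∧ δ ≤ (e i - e j) (T x))
    (R : ℕ → C(QS A,ℝ)) (N : ℕ) (η : ℝ) (hη : 0 < η) :
    ∃ e' : StrongDual ℝ E, ∃ h : C(QS A,ℝ), ‖e'‖ ≤ 1 ∧ (∀ ρ, |h ρ| ≤ 1) ∧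
      (∀ n < N, |m (h * R n)| ≤ η) ∧
      (∀ x : A, IsSelfAdjoint x → |e' (T x) - m (h * hat x)| ≤ η * Real.sqrt (m (hat (x*x)))) ∧
      ∃ x : A, IsSelfAdjoint x ∧ ‖x‖ ≤ 1 ∧ δ/2 ≤ e' (T x) := by
  let V := selfAdjoint.submodule ℝ A
  have hl : ∀ n, ∃ l : C(QS A,ℝ) →ₗ[ℝ] ℝ, (∀ x : V, l (hat (x:A)) = e n (T (x:A))) ∧ ∀ g, |l g| ≤ m |g| := by
    intro n
    obtain ⟨l, hl1, hl2⟩ := hb_ext m hm (V := V) (hat ∘ₗ V.subtype)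
      ((e n).toLinearMap ∘ₗ (T.restrictScalars ℝ).toLinearMap ∘ₗ V.subtype) (by
        intro x
        simp only [LinearMap.comp_apply, Submodule.subtype_apply, ContinuousLinearMap.coe_coe,
          ContinuousLinearMap.coe_restrictScalars']
        calc |e n (T (x:A))| ≤ ‖e n‖ * ‖T (x:A)‖ := (e n).le_opNorm _
          _ ≤ 1 * ‖T (x:A)‖ := by gcongr; exact he1 n
          _ ≤ _ := by rw [one_mul]; exact hT _ x.2)
    exact ⟨l, fun x => hl1 x, hl2⟩
  choose l hl1 hl2 using hl
  set S := ∑ n ∈ range N, Real.sqrt (m (R n * R n)) with hS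
  have hS0 : 0 ≤ S := sum_nonneg fun n _ => Real.sqrt_nonneg _
  set η1 := min η (η/2/(1+S)) with hη1
  have hη10 : 0 < η1 := lt_min hη (by positivity)
  have hpig : ∃ i j, i ≠ j ∧ ∀ n < N, |l i (R n) - l j (R n)| ≤ η := by
    let b : ℕ → (Fin N → ℝ) := fun i n => l i (R n)
    have hb : ∀ i, b i ∈ Metric.closedBall (0 : Fin N → ℝ) (∑ n ∈ range N, m |R n|) := by
      intro i
      have h0 : ∀ n, 0 ≤ m |R n| := fun n => hm _ (abs_nonneg _)
      rw [mem_closedBall_zero_iff, pi_norm_le_iff_of_nonneg (sum_nonneg fun n _ => h0 n)]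
      intro n
      exact (hl2 i (R n)).trans (single_le_sum (f := fun n => m |R n|) (fun n _ => h0 n) (mem_range.2 n.2))
    obtain ⟨a, -, φ, hφ, ha⟩ := (isCompact_closedBall _ _).tendsto_subseq hb
    obtain ⟨k, hk⟩ := Metric.cauchySeq_iff.1 ha.cauchySeq η hη
    refine ⟨φ (k+1), φ k, fun h => by have := hφ.injective h; omega, fun n hn => ?_⟩
    have := (dist_pi_lt_iff hη).1 (hk (k+1) (by omega) k le_rfl) ⟨n, hn⟩
    rw [Real.dist_eq] at this
    exact this.le
  obtain ⟨i, j, hij, hR⟩ := hpig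
  obtain ⟨h, hh1, hh2⟩ := sakai_ck m hm ((1/2:ℝ) • (l i - l j)) (by
    intro g
    have h1 := abs_le.1 (hl2 i g)
    have h2 := abs_le.1 (hl2 j g)
    simp only [LinearMap.smul_apply, LinearMap.sub_apply, smul_eq_mul]
    rw [abs_le]; constructor <;> linarith) η1 hη10
  refine ⟨(1/2:ℝ) • (e i - e j), h, ?_, hh1, ?_, ?_, ?_⟩
  · rw [norm_smul, Real.norm_of_nonneg (by norm_num)]
    have := norm_sub_le (e i) (e j)
    have := he1 i
    have := he1 j
    linarith
  · intro n hn
    have h1 := hh2 (R n)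
    have h2 := hR n hn
    have h3 : η1 * Real.sqrt (m (R n * R n)) ≤ η/2 := by
      calc η1 * Real.sqrt (m (R n * R n)) ≤ (η/2/(1+S)) * S := by
            gcongr
            · exact min_le_right _ _
            · exact single_le_sum (f := fun n => Real.sqrt (m (R n * R n))) (fun n _ => Real.sqrt_nonneg _) (mem_range.2 hn)
        _ ≤ (η/2/(1+S)) * (1+S) := by gcongr; linarith
        _ = η/2 := by field_simp
    simp only [LinearMap.smul_apply, LinearMap.sub_apply, smul_eq_mul] at h1
    rw [abs_le] at h1 h2 ⊢
    constructor <;> linarith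
  · intro x hx
    have h1 := hh2 (hat x)
    simp only [LinearMap.smul_apply, LinearMap.sub_apply, smul_eq_mul] at h1
    have e1 := hl1 i ⟨x, hx⟩
    have e2 := hl1 j ⟨x, hx⟩
    simp only at e1 e2
    rw [e1, e2] at h1
    refine le_trans (le_of_eq ?_) (h1.trans ?_)
    · simp
    · gcongr
      · exact min_le_left _ _
      · exact m_mono m hm (hat_sq x hx)
  · obtain ⟨x, h1, h2, h3⟩ := he2 i j hij
    refine ⟨x, h1, h2, ?_⟩
    simp only [_root_.smul_apply, smul_eq_mul]
    linarith

end tree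
end PS

namespace PS
open Finset

section tree2
variable {A : Type*} [CStarAlgebra A] [PartialOrder A] [StarOrderedRing A]
  {E : Type*} [NormedAddCommGroup E] [NormedSpace ℂ E]
lemma hat_one_le : hat (1:A) ≤ 1 := by
  intro ρ
  have := (abs_le.1 (ρ.2.1 (1:A))).2
  refine this.trans (norm_le_one' zero_le_one le_rfl)


lemma ctree (m : C(QS A,ℝ) →ₗ[ℝ] ℝ) (hm : ∀ g, 0 ≤ g → 0 ≤ m g)
    (T : A →L[ℂ] E) (hT : ∀ x : A, IsSelfAdjoint x → ‖T x‖ ≤ m |hat x|)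
    (δ : ℝ) (e0 : ℕ → StrongDual ℝ E) (he1 : ∀ n, ‖e0 n‖ ≤ 1)
    (he2 : ∀ i j, i ≠ j → ∃ x : A, IsSelfAdjoint x ∧ ‖x‖ ≤ 1 ∧ δ ≤ (e0 i - e0 j) (T x))
    (η : ℝ) (hη : 0 < η) :
    ∃ (R : ℕ → ℕ → C(QS A,ℝ)) (h : ℕ → C(QS A,ℝ)) (e : ℕ → StrongDual ℝ E),
      (R 0 = fun _ => 1) ∧ (∀ k, red (R (k+1)) = R k) ∧ (∀ k s, dif (R (k+1)) s = h k * R k s) ∧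
      (∀ k n, 0 ≤ R k n) ∧ (∀ k n, R k n ≤ 1) ∧
      (∀ k n, n < 2^k → 2^k * m (R k n) ≤ m 1 + 2^k * η) ∧ (∀ k, ‖e k‖ ≤ 1) ∧
      (∀ k, ∀ x : A, IsSelfAdjoint x →
        |e k (T x) - m (h k * hat x)| ≤ η * Real.sqrt (m (hat (x*x)))) ∧
      ∀ k, ∃ x : A, IsSelfAdjoint x ∧ ‖x‖ ≤ 1 ∧ δ/2 ≤ e k (T x) := by
  choose ee hh a1 a2 a3 a4 a5 using fun (R : ℕ → C(QS A,ℝ)) (k : ℕ) =>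
    step6 m hm T hT δ e0 he1 he2 R (2^k) η hη
  let st : ℕ → (ℕ → C(QS A,ℝ)) → (ℕ → C(QS A,ℝ)) := fun k R n =>
    R (n/2) * ((1/2:ℝ) • (1 + (if n % 2 = 0 then (1:ℝ) else -1) • hh R k))
  let R : ℕ → ℕ → C(QS A,ℝ) := fun k => Nat.rec (fun _ => 1) st k
  have R0 : R 0 = fun _ => 1 := rfl
  have Rs : ∀ k n, R (k+1) n = R k (n/2) * ((1/2:ℝ) • (1 + (if n % 2 = 0 then (1:ℝ) else -1) • hh (R k) k)) :=
    fun k n => rfl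
  have Re : ∀ k s, R (k+1) (2*s) = R k s * ((1/2:ℝ) • (1 + hh (R k) k)) := by
    intro k s
    rw [Rs, show 2*s/2 = s by omega, if_pos (by omega), one_smul]
  have Ro : ∀ k s, R (k+1) (2*s+1) = R k s * ((1/2:ℝ) • (1 - hh (R k) k)) := by
    intro k s
    rw [Rs, show (2*s+1)/2 = s by omega, if_neg (by omega), neg_one_smul, sub_eq_add_neg]
  have hcase : ∀ (P : ℕ → Prop), (∀ s, P (2*s)) → (∀ s, P (2*s+1)) → ∀ n, P n := by
    intro P h1 h2 n
    rcases Nat.even_or_odd' n with ⟨s, rfl | rfl⟩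
    · exact h1 s
    · exact h2 s
  have hR01 : ∀ k n, ∀ ρ, 0 ≤ R k n ρ ∧ R k n ρ ≤ 1 := by
    intro k
    induction k with
    | zero => intro n ρ; rw [R0]; simp
    | succ k ih =>
      refine hcase _ (fun s ρ => ?_) (fun s ρ => ?_)
      · rw [Re]
        obtain ⟨h1, h2⟩ := ih s ρ
        have h3 := abs_le.1 (a2 (R k) k ρ)
        simp only [ContinuousMap.mul_apply, ContinuousMap.smul_apply, ContinuousMap.add_apply,
          ContinuousMap.one_apply, smul_eq_mul]
        constructor
        · exact mul_nonneg h1 (by linarith)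
        · exact mul_le_one₀ h2 (by linarith) (by linarith)
      · rw [Ro]
        obtain ⟨h1, h2⟩ := ih s ρ
        have h3 := abs_le.1 (a2 (R k) k ρ)
        simp only [ContinuousMap.mul_apply, ContinuousMap.smul_apply, ContinuousMap.sub_apply,
          ContinuousMap.one_apply, smul_eq_mul]
        constructor
        · exact mul_nonneg h1 (by linarith)
        · exact mul_le_one₀ h2 (by linarith) (by linarith)
  refine ⟨R, fun k => hh (R k) k, fun k => ee (R k) k, R0, ?_, ?_, fun k n ρ => (hR01 k n ρ).1,
    fun k n ρ => (hR01 k n ρ).2, ?_, fun k => a1 _ _, fun k => a4 _ _, fun k => a5 _ _⟩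
  · intro k
    funext s
    simp only [red]
    rw [Re, Ro]
    ext ρ
    simp; ring
  · intro k s
    simp only [dif]
    rw [Re, Ro]
    ext ρ
    simp; ring
  · intro k
    induction k with
    | zero => intro n _; simp [R0]; exact hη.le
    | succ k ih =>
      refine hcase _ (fun s hs => ?_) (fun s hs => ?_)
      · have hs' : s < 2^k := by rw [pow_succ] at hs; omega
        have e1 : m (R (k+1) (2*s)) = (m (R k s) + m (hh (R k) k * R k s))/2 := by
          rw [Re, ← map_add, mul_smul_comm, map_smul, mul_add, mul_one, mul_comm (R k s), smul_eq_mul]; ring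
        have h1 := ih s hs'
        have h2 := (abs_le.1 (a3 (R k) k s hs')).2
        rw [e1, pow_succ]
        have h3 : (0:ℝ) < 2^k := by positivity
        nlinarith
      · have hs' : s < 2^k := by rw [pow_succ] at hs; omega
        have e1 : m (R (k+1) (2*s+1)) = (m (R k s) - m (hh (R k) k * R k s))/2 := by
          rw [Ro, ← map_sub, mul_smul_comm, map_smul, mul_sub, mul_one, mul_comm (R k s), smul_eq_mul]; ring
        have h1 := ih s hs'
        have h2 := (abs_le.1 (a3 (R k) k s hs')).1
        rw [e1, pow_succ]
        have h3 : (0:ℝ) < 2^k := by positivity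
        nlinarith

lemma m_cs (m : C(QS A,ℝ) →ₗ[ℝ] ℝ) (hm : ∀ g, 0 ≤ g → 0 ≤ m g)
    (R g : C(QS A,ℝ)) (hR0 : 0 ≤ R) (hR1 : R ≤ 1) : m (R*g)^2 ≤ m 1 * m (g*g) := by
  have h : ∀ r : ℝ, 0 ≤ m 1 * (r*r) + (2 * m (R*g)) * r + m (g*g) := by
    intro r
    have h1 := hm ((r • 1 + R*g)*(r • 1 + R*g)) (fun ρ => by
      simpa using mul_self_nonneg (r + R ρ * g ρ))
    have h2 : m ((R*g)*(R*g)) ≤ m (g*g) := m_mono m hm (fun ρ => by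
      have a : 0 ≤ R ρ := hR0 ρ
      have b : R ρ ≤ 1 := hR1 ρ
      change R ρ * g ρ * (R ρ * g ρ) ≤ g ρ * g ρ
      nlinarith [mul_nonneg (mul_nonneg (sub_nonneg.2 b) (by linarith : 0 ≤ 1 + R ρ)) (mul_self_nonneg (g ρ))])
    have e : (r • (1:C(QS A,ℝ)) + R*g)*(r • 1 + R*g) = (r*r) • (1:C(QS A,ℝ)) + (2*r) • (R*g) + (R*g)*(R*g) := by
      ext ρ; simp; ring
    rw [e, map_add, map_add, map_smul, map_smul, smul_eq_mul, smul_eq_mul] at h1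
    linarith
  have := quad_le h
  nlinarith

lemma leaves (m : C(QS A,ℝ) →ₗ[ℝ] ℝ) (hm : ∀ g, 0 ≤ g → 0 ≤ m g)
    (R : ℕ → C(QS A,ℝ)) (hR0 : ∀ n, 0 ≤ R n) (hR1 : ∀ n, R n ≤ 1) (N : ℕ) (hN : 0 < N)
    (hsum : ∑ n ∈ range N, R n = 1) (θ ζ : ℝ) (hθ : 0 < θ) (hζ : 0 < ζ) :
    ∃ x x' : ℕ → A, (∀ n, 0 ≤ x n) ∧ (∀ n, 0 ≤ x' n) ∧ ∑ n ∈ range N, x' n ≤ 1 ∧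
      (∀ n, ∀ u : A, IsSelfAdjoint u →
        |m (R n * hat u) - m (hat (x n * u + u * x n))/2| ≤ ζ/N * Real.sqrt (m (hat (u*u)))) ∧
      ∀ n, m |hat (x' n) - hat (x n)| ≤ θ/N := by
  have hm1 : 0 ≤ m 1 := hm 1 zero_le_one
  have hN' : (0:ℝ) < N := by exact_mod_cast hN
  set τ := θ/N/2/(m 1 + 1) with hτ
  have hτ0 : 0 < τ := by positivity
  set q := θ/N/2/(1+1/τ) with hq
  have hq0 : 0 < q := by positivity
  set ζ1 := min ζ (Real.sqrt q) with hζ1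
  have hζ10 : 0 < ζ1 := lt_min hζ (Real.sqrt_pos.2 hq0)
  have hx : ∀ n, ∃ x : A, 0 ≤ x ∧ x ≤ 1 ∧ ∀ u, IsSelfAdjoint u →
      |m (R n * hat u) - m (hat (x*u+u*x))/2| ≤ ζ1/N * Real.sqrt (m (hat (u*u))) := by
    intro n
    have := sakai_cstar (m ∘ₗ hat) (fun a ha => hm _ (hat_nonneg a ha))
      (m ∘ₗ (LinearMap.mulLeft ℝ (R n)) ∘ₗ hat) (m 1) (by
        intro u hu
        refine (m_cs m hm (R n) (hat u) (hR0 n) (hR1 n)).trans ?_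
        exact mul_le_mul_of_nonneg_left (m_mono m hm (hat_sq u hu)) hm1) (by
        intro u v hu hv huv
        refine m_mono m hm (fun ρ => ?_)
        have a : 0 ≤ R n ρ := hR0 n ρ
        have b : R n ρ ≤ 1 := hR1 n ρ
        have c : hat u ρ ≤ hat v ρ := hat_mono huv ρ
        have d : 0 ≤ hat v ρ := hat_nonneg v hv ρ
        change R n ρ * hat u ρ ≤ hat v ρ
        nlinarith) (ζ1/N) (by positivity)
    exact this
  choose x hx0 hx1 hx2 using hx
  obtain ⟨x', hx'0, hx'1, hx'2⟩ := normalise N x hx0 hx1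
  refine ⟨x, x', hx0, hx'0, hx'1, fun n u hu => (hx2 n u hu).trans ?_, fun n => ?_⟩
  · gcongr; exact min_le_left _ _
  set y := ∑ n ∈ range N, x n with hy
  have hysa : IsSelfAdjoint (y - 1) := (IsSelfAdjoint.of_nonneg (sum_nonneg fun n _ => hx0 n)).sub (.one A)
  have hf0 : 0 ≤ m (hat ((y-1)*(y-1))) := hm _ (hat_nonneg _ hysa.mul_self_nonneg)
  have hfy : m (hat ((y-1)*(y-1))) ≤ q := by
    have e1 : m (hat ((y-1)*(y-1))) = -∑ n ∈ range N, (m (R n * hat (y-1)) - m (hat (x n * (y-1) + (y-1) * x n))/2) := by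
      rw [sum_sub_distrib, ← map_sum, ← sum_mul, hsum, one_mul, ← sum_div, ← map_sum, ← map_sum,
        sum_add_distrib, ← sum_mul, ← mul_sum, ← hy]
      have : (y-1)*(y-1) = (1/2:ℝ) • (y * (y-1) + (y-1)*y) - (y-1) := by
        have : y * (y-1) + (y-1)*y = (2:ℝ) • (y * y - y) := by rw [two_smul]; noncomm_ring
        rw [this, smul_smul]; norm_num; noncomm_ring
      rw [this, map_sub, map_sub, map_smul, map_smul, smul_eq_mul]; ring
    have e2 : m (hat ((y-1)*(y-1))) ≤ ζ1 * Real.sqrt (m (hat ((y-1)*(y-1)))) := by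
      calc m (hat ((y-1)*(y-1))) ≤ ∑ n ∈ range N, |m (R n * hat (y-1)) - m (hat (x n * (y-1) + (y-1) * x n))/2| := by
            rw [e1]; exact (neg_le_abs _).trans (abs_sum_le_sum_abs _ _)
        _ ≤ ∑ n ∈ range N, ζ1/N * Real.sqrt (m (hat ((y-1)*(y-1)))) := sum_le_sum fun n _ => hx2 n _ hysa
        _ = _ := by rw [sum_const, card_range, nsmul_eq_mul]; field_simp
    have e3 : ζ1 ^2 ≤ q := by
      calc ζ1^2 ≤ (Real.sqrt q)^2 := by gcongr; exact min_le_right _ _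
        _ = q := Real.sq_sqrt hq0.le
    have e4 := Real.mul_self_sqrt hf0
    have e5 := Real.sqrt_nonneg (m (hat ((y-1)*(y-1))))
    set w := Real.sqrt (m (hat ((y-1)*(y-1))))
    have e6 : w ≤ ζ1 := by
      by_contra hc
      push Not at hc
      nlinarith
    nlinarith
  refine (m_mono m hm (hx'2 n τ hτ0)).trans ?_
  rw [map_add, map_smul, map_smul, smul_eq_mul, smul_eq_mul]
  have h1 : (1+1/τ) * m (hat ((y-1)*(y-1))) ≤ θ/N/2 := by
    calc (1+1/τ) * m (hat ((y-1)*(y-1))) ≤ (1+1/τ) * q := by gcongr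
      _ = θ/N/2 := by rw [hq]; field_simp
  have h2 : τ * m 1 ≤ θ/N/2 := by
    calc τ * m 1 ≤ τ * (m 1 + 1) := by gcongr; linarith
      _ = θ/N/2 := by rw [hτ]; field_simp
  linarith

end tree2
end PS

namespace PS
open Finset

section tree3
variable {A : Type*} [CStarAlgebra A] [PartialOrder A] [StarOrderedRing A]
  {E : Type*} [NormedAddCommGroup E] [NormedSpace ℂ E]

lemma f_cs (m : C(QS A,ℝ) →ₗ[ℝ] ℝ) (hm : ∀ g, 0 ≤ g → 0 ≤ m g)
    (x u : A) (hx : IsSelfAdjoint x) (hu : IsSelfAdjoint u) :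
    |m (hat (x*u+u*x))/2| ≤ Real.sqrt (m (hat (x*x))) * Real.sqrt (m (hat (u*u))) := by
  have h : ∀ r : ℝ, 0 ≤ m (hat (x*x)) * (r*r) + m (hat (x*u+u*x)) * r + m (hat (u*u)) := by
    intro r
    have h1 := hm _ (hat_nonneg ((r • x + u)*(r • x + u)) ((((IsSelfAdjoint.all r).smul hx).add hu).mul_self_nonneg))
    have e : (r • x + u)*(r • x + u) = (r*r) • (x*x) + r • (x*u+u*x) + u*u := by
      simp only [add_mul, mul_add, smul_mul_assoc, mul_smul_comm, smul_add, smul_smul]; abel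
    rw [e, map_add, map_add, map_add, map_add, map_smul, map_smul, map_smul, map_smul, smul_eq_mul, smul_eq_mul] at h1
    linarith
  have h2 := quad_le h
  rw [← Real.sqrt_mul (hm _ (hat_nonneg _ hx.mul_self_nonneg))]
  apply Real.abs_le_sqrt
  linarith

lemma lower (m : C(QS A,ℝ) →ₗ[ℝ] ℝ) (hm : ∀ g, 0 ≤ g → 0 ≤ m g)
    (T : A →L[ℂ] E) (e : StrongDual ℝ E) (h : C(QS A,ℝ)) (X : A) (hX : IsSelfAdjoint X)
    (D η ζ S : ℝ) (hD : 0 < D) (hS : 0 < S) (hS1 : m 1 ≤ S^2)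
    (h1 : ∀ x : A, IsSelfAdjoint x → |e (T x) - m (h * hat x)| ≤ η * Real.sqrt (m (hat (x*x))))
    (h2 : ∀ x : A, IsSelfAdjoint x → |m (h * hat x) - m (hat (X * x + x * X))/2| ≤ ζ * Real.sqrt (m (hat (x*x))))
    (h3 : ∃ x : A, IsSelfAdjoint x ∧ ‖x‖ ≤ 1 ∧ D ≤ e (T x))
    (hη : 0 < η) (hζ : 0 < ζ) (hηD : η ≤ D/(8*S)) (hζD : ζ ≤ D/(8*S)) :
    D^2/(8*S^2) ≤ e (T X) := by
  obtain ⟨x, hx, hx1, hxD⟩ := h3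
  have k1 : ∀ u : A, IsSelfAdjoint u → |e (T u) - m (hat (X * u + u * X))/2| ≤ (η+ζ) * Real.sqrt (m (hat (u*u))) := by
    intro u hu
    have a := h1 u hu
    have b := h2 u hu
    rw [abs_le] at a b ⊢
    constructor <;> linarith
  have hnx : Real.sqrt (m (hat (x*x))) ≤ S := by
    rw [Real.sqrt_le_left hS.le]
    refine le_trans ?_ hS1
    have := sq_le_norm x hx 1 hx1
    rw [one_pow, one_smul] at this
    exact m_mono m hm ((hat_mono this).trans hat_one_le)
  have a1 := abs_le.1 (k1 x hx)
  have a2 := abs_le.1 (f_cs m hm X x hX hx)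
  have a3 := abs_le.1 (k1 X hX)
  have e1 : m (hat (X*X+X*X))/2 = Real.sqrt (m (hat (X*X))) * Real.sqrt (m (hat (X*X))) := by
    rw [Real.mul_self_sqrt (hm _ (hat_nonneg _ hX.mul_self_nonneg)), map_add, map_add]; ring
  rw [e1] at a3
  have n0 := Real.sqrt_nonneg (m (hat (X*X)))
  have n1 := Real.sqrt_nonneg (m (hat (x*x)))
  set w := Real.sqrt (m (hat (X*X)))
  set v := Real.sqrt (m (hat (x*x)))
  set κ := D/(8*S) with hκ
  have hκS : D = 8 * S * κ := by rw [hκ]; field_simp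
  have hκ0 : 0 < κ := by positivity
  have b1 : D ≤ (w + 2*κ) * S := by
    have : (η+ζ) * v ≤ 2*κ*S := by gcongr; linarith
    nlinarith
  have b2 : 6*κ ≤ w := by
    rw [hκS] at b1
    have : 8*κ ≤ w + 2*κ := by
      refine le_of_mul_le_mul_right ?_ hS
      linarith
    linarith
  have b3 : (η+ζ)*w ≤ 2*κ*w := by gcongr; linarith
  have b4 : D^2/(8*S^2) = 8*κ^2 := by rw [hκS]; field_simp
  rw [b4]
  nlinarith

lemma treelemma (m : C(QS A,ℝ) →ₗ[ℝ] ℝ) (hm : ∀ g, 0 ≤ g → 0 ≤ m g)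
    (T : A →L[ℂ] E) (hT : ∀ x : A, IsSelfAdjoint x → ‖T x‖ ≤ m |hat x|)
    (δ : ℝ) (hδ : 0 < δ) (e0 : ℕ → StrongDual ℝ E) (he1 : ∀ n, ‖e0 n‖ ≤ 1)
    (he2 : ∀ i j, i ≠ j → ∃ x : A, IsSelfAdjoint x ∧ ‖x‖ ≤ 1 ∧ δ ≤ (e0 i - e0 j) (T x)) :
    ∃ c0 > 0, ∃ U ≥ (1:ℝ), ∀ L : ℕ, ∃ x' : ℕ → A, (∀ n, 0 ≤ x' n) ∧ ∑ n ∈ range (2^L), x' n ≤ 1 ∧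
      ∀ j < L, (∀ s < 2^(L-1-j), 2^(L-1-j) * ‖T (dif (red^[j] x') s)‖ ≤ U) ∧
        c0 ≤ ∑ s ∈ range (2^(L-1-j)), ‖T (dif (red^[j] x') s)‖ := by
  have hm1 : 0 ≤ m 1 := hm 1 zero_le_one
  set S := m 1 + 1 with hS
  have hS1 : 1 ≤ S := by linarith
  have hS0 : 0 < S := by linarith
  have hSS : m 1 ≤ S^2 := by nlinarith
  set D := δ/2 with hD
  have hD0 : 0 < D := by positivity
  refine ⟨D^2/(16*S^2), by positivity, m 1 + 3, by linarith, fun L => ?_⟩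
  set η := min ((2^L)⁻¹) (D/(8*S)) with hη
  have hη0 : 0 < η := by positivity
  obtain ⟨R, h, e, R0, Rred, Rdif, Rnn, Rle, Rm, en, eh, ex⟩ := ctree m hm T hT δ e0 he1 he2 η hη0
  have Riter : ∀ j k, red^[j] (R (k+j)) = R k := by
    intro j
    induction j with
    | zero => intro k; rfl
    | succ j ih =>
      intro k
      rw [Function.iterate_succ_apply, ← add_assoc, Rred, ih]
  have Rsum : ∑ n ∈ range (2^L), R L n = 1 := by
    have := sum_red_iter (R L) L 0
    rw [zero_add] at this
    rw [← this]
    have := Riter L 0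
    rw [zero_add] at this
    rw [this, R0]; simp
  set θ := min 1 (D^2/(16*S^2)) with hθ
  have hθ0 : 0 < θ := by positivity
  set ζ := min (1/S) (D/(8*S)) with hζ
  have hζ0 : 0 < ζ := by positivity
  obtain ⟨x, x', x0, x'0, x'1, hx, hxx⟩ := leaves m hm (R L) (Rnn L) (Rle L) (2^L) (by positivity) Rsum θ ζ hθ0 hζ0
  push_cast at hx hxx
  have xsa : ∀ n, IsSelfAdjoint (x n) := fun n => .of_nonneg (x0 n)
  have x'sa : ∀ n, IsSelfAdjoint (x' n) := fun n => .of_nonneg (x'0 n)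
  have redsa : ∀ j (y : ℕ → A), (∀ n, IsSelfAdjoint (y n)) → ∀ s, IsSelfAdjoint (red^[j] y s) := by
    intro j
    induction j with
    | zero => intro y hy s; exact hy s
    | succ j ih =>
      intro y hy s
      rw [Function.iterate_succ_apply]
      exact ih _ (fun n => (hy _).add (hy _)) s
  have altsa : ∀ k j (y : ℕ → A), (∀ n, IsSelfAdjoint (y n)) → IsSelfAdjoint (alt k j y) := by
    intro k j y hy
    exact isSelfAdjoint_sum _ fun s _ => (redsa j y hy _).sub (redsa j y hy _)
  refine ⟨x', x'0, x'1, fun j hj => ?_⟩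
  obtain ⟨k, rfl⟩ : ∃ k, L = k + (j+1) := ⟨L-1-j, by omega⟩
  rw [show k + (j+1) - 1 - j = k by omega]
  have hpow : (2:ℝ)^(k+(j+1)) = 2^k * 2^(j+1) := pow_add _ _ _
  constructor
  · intro s hs
    have u1 : ∀ n, m (hat (x' n)) ≤ m (R (k+(j+1)) n) + (θ + ζ * S)/2^(k+(j+1)) := by
      intro n
      have a1 : m (hat (x' n)) ≤ m (hat (x n)) + θ/2^(k+(j+1)) := by
        have := (le_abs_self _).trans ((m_abs m hm (hat (x' n) - hat (x n))).trans (hxx n))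
        rw [map_sub] at this
        linarith
      have a2 := (abs_le.1 (hx n 1 (.one A))).1
      rw [mul_one, one_mul, mul_one, map_add, map_add] at a2
      have a3 : m (R (k+(j+1)) n * hat 1) ≤ m (R (k+(j+1)) n) := by
        refine m_mono m hm fun ρ => ?_
        have q1 : hat (1:A) ρ ≤ 1 := hat_one_le ρ
        have q2 : 0 ≤ R (k+(j+1)) n ρ := Rnn _ n ρ
        change R (k+(j+1)) n ρ * hat 1 ρ ≤ R (k+(j+1)) n ρ
        nlinarith
      have a4 : Real.sqrt (m (hat 1)) ≤ S := by
        rw [Real.sqrt_le_left hS0.le]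
        exact (m_mono m hm hat_one_le).trans hSS
      have a5 : ζ/2^(k+(j+1)) * Real.sqrt (m (hat 1)) ≤ ζ/2^(k+(j+1)) * S := by gcongr
      rw [add_div, mul_div_right_comm]
      linarith
    have u2 : ‖T (dif (red^[j] x') s)‖ ≤ m (hat (red^[j+1] x' s)) := by
      refine (hT _ ((redsa j x' x'sa _).sub (redsa j x' x'sa _))).trans (m_mono m hm fun ρ => ?_)
      have q1 : 0 ≤ hat (red^[j] x' (2*s)) ρ := hat_nonneg _ (red_nonneg j x' x'0 _) ρ
      have q2 : 0 ≤ hat (red^[j] x' (2*s+1)) ρ := hat_nonneg _ (red_nonneg j x' x'0 _) ρ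
      rw [Function.iterate_succ_apply']
      change |hat (red^[j] x' (2*s) - red^[j] x' (2*s+1)) ρ| ≤ hat (red^[j] x' (2*s) + red^[j] x' (2*s+1)) ρ
      rw [map_sub, map_add]
      change |hat (red^[j] x' (2*s)) ρ - hat (red^[j] x' (2*s+1)) ρ| ≤ hat (red^[j] x' (2*s)) ρ + hat (red^[j] x' (2*s+1)) ρ
      rw [abs_le]; constructor <;> linarith
    have u3 : m (hat (red^[j+1] x' s)) = red^[j+1] (fun n => m (hat (x' n))) s :=
      red_map (m ∘ₗ hat).toAddMonoidHom (j+1) x' s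
    have u4 : red^[j+1] (fun n => m (R (k+(j+1)) n)) s = m (R k s) := by
      have := red_map m.toAddMonoidHom (j+1) (R (k+(j+1))) s
      rw [Riter] at this
      exact this.symm
    have u5 := red_mono (j+1) _ _ k s hs (fun n _ => u1 n)
    rw [red_add, red_const, u4, ← u3] at u5
    have u6 := Rm k s hs
    have u7 : (2:ℝ)^k * η ≤ 1 := by
      calc (2:ℝ)^k * η ≤ 2^k * (2^(k+(j+1)))⁻¹ := by gcongr; exact min_le_left _ _
        _ ≤ 2^k * (2^k)⁻¹ := by gcongr <;> norm_num
        _ = 1 := by field_simp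
    have u8 : ζ * S ≤ 1 := by
      calc ζ * S ≤ 1/S * S := by gcongr; exact min_le_left _ _
        _ = 1 := by field_simp
    have u9 : θ ≤ 1 := min_le_left _ _
    calc 2^k * ‖T (dif (red^[j] x') s)‖ ≤ 2^k * (m (R k s) + 2^(j+1) * ((θ + ζ * S)/2^(k+(j+1)))) := by
          gcongr; exact u2.trans u5
      _ = 2^k * m (R k s) + (θ + ζ*S) := by rw [hpow]; field_simp
      _ ≤ _ := by linarith
  · have l1 : alt k j (R (k+(j+1))) = h k := by
      have e1 : red^[j] (R (k+(j+1))) = R (k+1) := by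
        rw [show k+(j+1) = (k+1)+j by ring, Riter]
      simp only [alt, e1, Rdif]
      rw [← mul_sum]
      have := sum_red_iter (R k) k 0
      rw [zero_add] at this
      have h2 := Riter k 0
      rw [zero_add] at h2
      rw [← this, h2, R0]; simp
    have l2 : ∀ u : A, IsSelfAdjoint u → |m (h k * hat u) - m (hat (alt k j x * u + u * alt k j x))/2|
        ≤ ζ * Real.sqrt (m (hat (u*u))) := by
      intro u hu
      have b1 : m (h k * hat u) = alt k j (fun n => m (R (k+(j+1)) n * hat u)) := by
        rw [← l1]
        exact alt_map (m ∘ₗ LinearMap.mulRight ℝ (hat u)).toAddMonoidHom k j (R (k+(j+1)))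
      have b2 : m (hat (alt k j x * u + u * alt k j x))/2 = alt k j (fun n => m (hat (x n * u + u * x n))/2) := by
        have := alt_map ((1/2:ℝ) • (m ∘ₗ hat ∘ₗ (LinearMap.mulRight ℝ u + LinearMap.mulLeft ℝ u))).toAddMonoidHom k j x
        simp only [LinearMap.toAddMonoidHom_coe, LinearMap.smul_apply, LinearMap.comp_apply, LinearMap.add_apply,
          LinearMap.mulRight_apply, LinearMap.mulLeft_apply, smul_eq_mul, one_div_mul_eq_div] at this
        exact this
      rw [b1, b2, ← alt_sub]
      refine (alt_abs_le _ _ _).trans ?_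
      calc _ ≤ ∑ n ∈ range (2^(k+(j+1))), ζ/2^(k+(j+1)) * Real.sqrt (m (hat (u*u))) :=
            sum_le_sum fun n _ => hx n u hu
        _ = _ := by rw [sum_const, card_range, nsmul_eq_mul]; push_cast; field_simp
    have l3 := lower m hm T (e k) (h k) (alt k j x) (altsa k j x xsa) D η ζ S hD0 hS0 hSS (eh k) l2 (ex k)
      hη0 hζ0 (min_le_right _ _) (min_le_right _ _)
    have l4 : ‖T (alt k j x') - T (alt k j x)‖ ≤ θ := by
      rw [← map_sub, ← alt_sub]
      refine (hT _ (altsa k j _ fun n => (x'sa n).sub (xsa n))).trans ?_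
      calc m |hat (alt k j fun n => x' n - x n)| ≤ m (∑ n ∈ range (2^(k+(j+1))), |hat (x' n) - hat (x n)|) := by
            refine m_mono m hm fun ρ => ?_
            change |hat (alt k j fun n => x' n - x n) ρ| ≤ (∑ n ∈ range (2^(k+(j+1))), |hat (x' n) - hat (x n)|) ρ
            rw [ContinuousMap.sum_apply]
            have b1 : hat (alt k j fun n => x' n - x n) ρ = alt k j (fun n => hat (x' n) ρ - hat (x n) ρ) := by
              have := alt_map (ρ.1.toLinearMap).toAddMonoidHom k j (fun n => x' n - x n)
              simp only [LinearMap.toAddMonoidHom_coe, map_sub] at this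
              exact this
            rw [b1]
            exact alt_abs_le _ _ _
        _ ≤ ∑ n ∈ range (2^(k+(j+1))), θ/2^(k+(j+1)) := by
            rw [map_sum]; exact sum_le_sum fun n _ => hxx n
        _ = θ := by rw [sum_const, card_range, nsmul_eq_mul]; push_cast; field_simp
    have l5 : ∀ z : E, e k z ≤ ‖z‖ := fun z => by
      calc e k z ≤ ‖e k z‖ := le_abs_self _
        _ ≤ ‖e k‖ * ‖z‖ := (e k).le_opNorm z
        _ ≤ 1 * ‖z‖ := by gcongr; exact en k
        _ = ‖z‖ := one_mul _
    have l6 : ‖T (alt k j x')‖ ≤ ∑ s ∈ range (2^k), ‖T (dif (red^[j] x') s)‖ := by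
      rw [alt, map_sum]; exact norm_sum_le _ _
    have l7 := l5 (T (alt k j x))
    have l8 := norm_sub_norm_le (T (alt k j x)) (T (alt k j x'))
    rw [norm_sub_rev] at l8
    have l9 : θ ≤ D^2/(16*S^2) := min_le_right _ _
    have l10 : D^2/(8*S^2) = 2 * (D^2/(16*S^2)) := by field_simp; norm_num
    linarith

end tree3
end PS

namespace PS
open Finset

section final

lemma rpow_sub_le {p a b c : ℝ} (hp0 : 0 < p) (hp1 : p < 1) (ha : 0 ≤ a) (hb : 0 ≤ b) (hc : 0 ≤ c)
    (h : a ≤ b + c) : a^p ≤ b^p + c^p :=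
  (Real.rpow_le_rpow ha h hp0.le).trans (Real.rpow_add_le_add_rpow hb hc hp0.le hp1.le)

lemma lev_sub {p : ℝ} (hp0 : 0 < p) (hp1 : p < 1) (k : ℕ) (F G H : ℕ → ℝ)
    (h : ∀ s, |H s| ≤ |F s| + |G s|) : lev p k H ≤ lev p k F + lev p k G := by
  unfold lev
  rw [← mul_add, ← sum_add_distrib]
  gcongr with s hs
  refine rpow_sub_le hp0 hp1 (by positivity) (by positivity) (by positivity) ?_
  rw [← mul_add]
  gcongr
  exact h s

lemma lev_nonneg (p : ℝ) (k : ℕ) (F : ℕ → ℝ) : 0 ≤ lev p k F :=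
  mul_nonneg (by positivity) (sum_nonneg fun s _ => Real.rpow_nonneg (by positivity) _)

variable {A : Type*} [CStarAlgebra A] [PartialOrder A] [StarOrderedRing A]

lemma pos_part_sum (N : ℕ) (x : ℕ → A) (hx0 : ∀ n, 0 ≤ x n) (hx1 : ∑ n ∈ range N, x n ≤ 1)
    (ψ : A →ₗ[ℝ] ℝ) (hψ : ∀ a, |ψ a| ≤ ‖a‖) : ∑ n ∈ range N, max (ψ (x n)) 0 ≤ 1 := by
  have e : ∀ n, max (ψ (x n)) 0 = if 0 ≤ ψ (x n) then ψ (x n) else 0 := by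
    intro n
    split_ifs with h
    · exact max_eq_left h
    · exact max_eq_right (le_of_not_ge h)
  simp only [e]
  rw [← sum_filter, ← map_sum]
  refine (le_abs_self _).trans ((hψ _).trans (norm_le_one' (sum_nonneg fun n _ => hx0 n) (le_trans ?_ hx1)))
  exact sum_le_sum_of_subset_of_nonneg (filter_subset _ _) fun n _ _ => hx0 n

lemma real_est {p τ : ℝ} (hp0 : 0 < p) (hp1 : p < 1) (hτ : 0 < τ) (L : ℕ) (x : ℕ → A) (hx0 : ∀ n, 0 ≤ x n)
    (hx1 : ∑ n ∈ range (2^L), x n ≤ 1) (ψ : A →ₗ[ℝ] ℝ) (hψ : ∀ a, |ψ a| ≤ ‖a‖) :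
    ∑ j ∈ range L, lev p (L-1-j) (fun s => ψ (dif (red^[j] x) s)) ≤ 2 * (τ*L + τ^(1-2/p)/(p*(1-p)/6)) := by
  set F : ℕ → ℝ := fun n => max (ψ (x n)) 0 with hF
  set G : ℕ → ℝ := fun n => max ((-ψ) (x n)) 0 with hG
  have hQ : 0 ≤ τ^(1-2/p)/(p*(1-p)/6) := by
    have : 0 < 1 - p := by linarith
    have := Real.rpow_pos_of_pos hτ (1-2/p)
    positivity
  have hF1 := (mart hp0 hp1 hτ L F (fun n => le_max_right _ _) (pos_part_sum _ x hx0 hx1 ψ hψ)).2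
  have hG1 := (mart hp0 hp1 hτ L G (fun n => le_max_right _ _) (pos_part_sum _ x hx0 hx1 (-ψ) (fun a => by
    rw [LinearMap.neg_apply, abs_neg]; exact hψ a))).2
  have hF2 := mul_nonneg hQ (lev_nonneg p L F)
  have hG2 := mul_nonneg hQ (lev_nonneg p L G)
  have key : ∑ j ∈ range L, lev p (L-1-j) (fun s => ψ (dif (red^[j] x) s)) ≤
      ∑ j ∈ range L, (lev p (L-1-j) (dif (red^[j] F)) + lev p (L-1-j) (dif (red^[j] G))) := by
    refine sum_le_sum fun j _ => lev_sub hp0 hp1 _ _ _ _ fun s => ?_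
    have e1 : ψ (dif (red^[j] x) s) = dif (red^[j] (fun n => F n - G n)) s := by
      have := dif_map ψ.toAddMonoidHom j x s
      have e2 : (fun n => F n - G n) = fun n => ψ (x n) := by
        funext n
        simp only [hF, hG, LinearMap.neg_apply]
        rcases le_total 0 (ψ (x n)) with h | h
        · rw [max_eq_left h, max_eq_right (by linarith), sub_zero]
        · rw [max_eq_right h, max_eq_left (by linarith)]; ring
      rw [e2]; exact this
    rw [e1]
    have e3 : dif (red^[j] (fun n => F n - G n)) s = dif (red^[j] F) s - dif (red^[j] G) s := by
      simp only [dif, red_sub]; ring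
    rw [e3]
    exact abs_sub _ _
  rw [sum_add_distrib] at key
  linarith

lemma scale {p w : ℝ} (hp0 : 0 < p) (k : ℕ) (hw : 0 ≤ w) :
    (((2:ℝ)^k)^(1-1/p) * w)^p = ((2:ℝ)^k)⁻¹ * ((2:ℝ)^k * w)^p := by
  have h2 : (0:ℝ) < 2^k := by positivity
  rw [Real.mul_rpow (by positivity) hw, Real.mul_rpow h2.le hw, ← Real.rpow_mul h2.le, ← mul_assoc]
  congr 1
  rw [show (1-1/p)*p = -1 + p by field_simp; ring, Real.rpow_add h2, Real.rpow_neg_one]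

variable {E : Type*} [NormedAddCommGroup E] [NormedSpace ℂ E]

lemma upper_est {p τ C : ℝ} (hp0 : 0 < p) (hp1 : p < 1) (hτ : 0 < τ) (T : A →L[ℂ] E) (hT : PSum' p T C)
    (L : ℕ) (x : ℕ → A) (hx0 : ∀ n, 0 ≤ x n) (hx1 : ∑ n ∈ range (2^L), x n ≤ 1) :
    ∑ j ∈ range L, lev p (L-1-j) (fun s => ‖T (dif (red^[j] x) s)‖) ≤
      C * (4 * (τ*L + τ^(1-2/p)/(p*(1-p)/6))) := by
  have hsum : ∀ g : ℕ → ℕ → ℝ, (∀ j s, 0 ≤ g j s) →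
      ∑ j ∈ range L, lev p (L-1-j) (g j) =
      ∑ i ∈ (range L).sigma (fun j => range (2^(L-1-j))), (((2:ℝ)^(L-1-i.1))^(1-1/p) * g i.1 i.2)^p := by
    intro g hg
    rw [sum_sigma]
    refine sum_congr rfl fun j _ => ?_
    rw [lev, mul_sum]
    refine sum_congr rfl fun s _ => ?_
    rw [scale hp0 _ (hg j s), abs_of_nonneg (hg j s)]
  have h := hT.2 ((range L).sigma (fun j => range (2^(L-1-j))))
    (fun i => (((2:ℝ)^(L-1-i.1))^(1-1/p)) • dif (red^[i.1] x) i.2) (4 * (τ*L + τ^(1-2/p)/(p*(1-p)/6))) ?_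
  · rw [hsum _ (fun j s => norm_nonneg _)]
    refine le_trans (le_of_eq ?_) h
    refine sum_congr rfl fun i _ => ?_
    have : T ((((2:ℝ)^(L-1-i.1))^(1-1/p)) • dif (red^[i.1] x) i.2) =
      (((2:ℝ)^(L-1-i.1))^(1-1/p)) • T (dif (red^[i.1] x) i.2) := (T.restrictScalars ℝ).map_smul _ _
    rw [this, norm_smul, Real.norm_of_nonneg (by positivity)]
  · intro φ hφ
    have hφa : ∀ a, ‖φ a‖ ≤ ‖a‖ := fun a => by
      refine (φ.le_opNorm a).trans ?_
      have := norm_nonneg a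
      nlinarith
    have r1 := real_est hp0 hp1 hτ L x hx0 hx1 (Complex.reLm ∘ₗ (φ.restrictScalars ℝ).toLinearMap)
      (fun a => (Complex.abs_re_le_norm _).trans (hφa a))
    have r2 := real_est hp0 hp1 hτ L x hx0 hx1 (Complex.imLm ∘ₗ (φ.restrictScalars ℝ).toLinearMap)
      (fun a => (Complex.abs_im_le_norm _).trans (hφa a))
    have r3 : ∑ j ∈ range L, lev p (L-1-j) (fun s => ‖φ (dif (red^[j] x) s)‖) ≤
      ∑ j ∈ range L, (lev p (L-1-j) (fun s => (Complex.reLm ∘ₗ (φ.restrictScalars ℝ).toLinearMap) (dif (red^[j] x) s)) +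
       lev p (L-1-j) (fun s => (Complex.imLm ∘ₗ (φ.restrictScalars ℝ).toLinearMap) (dif (red^[j] x) s))) := by
      refine sum_le_sum fun j _ => lev_sub hp0 hp1 _ _ _ _ fun s => ?_
      rw [abs_of_nonneg (norm_nonneg _)]
      exact Complex.norm_le_abs_re_add_abs_im _
    rw [sum_add_distrib, hsum _ (fun j s => norm_nonneg _)] at r3
    refine le_trans (le_of_eq ?_) (r3.trans (by linarith))
    refine sum_congr rfl fun i _ => ?_
    have : φ ((((2:ℝ)^(L-1-i.1))^(1-1/p)) • dif (red^[i.1] x) i.2) =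
      (((2:ℝ)^(L-1-i.1))^(1-1/p)) • φ (dif (red^[i.1] x) i.2) := (φ.restrictScalars ℝ).map_smul _ _
    rw [this, norm_smul, Real.norm_of_nonneg (by positivity)]

lemma lower_est {p U c0 : ℝ} (hp0 : 0 < p) (hp1 : p < 1) (hU : 1 ≤ U) (k : ℕ) (w : ℕ → ℝ) (hw : ∀ s, 0 ≤ w s)
    (h1 : ∀ s < 2^k, 2^k * w s ≤ U) (h2 : c0 ≤ ∑ s ∈ range (2^k), w s) :
    c0 * U^(p-1) ≤ lev p k w := by
  have hU0 : 0 < U^(p-1) := Real.rpow_pos_of_pos (by linarith) _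
  calc c0 * U^(p-1) ≤ (∑ s ∈ range (2^k), w s) * U^(p-1) := by gcongr
    _ = ((2:ℝ)^k)⁻¹ * ∑ s ∈ range (2^k), (2^k * w s) * U^(p-1) := by
      rw [mul_sum, sum_mul]
      refine sum_congr rfl fun s _ => ?_
      field_simp
    _ ≤ lev p k w := by
      unfold lev
      gcongr with s hs
      rw [abs_of_nonneg (hw s)]
      have hs' := h1 s (mem_range.1 hs)
      have h0 : (0:ℝ) ≤ 2^k * w s := mul_nonneg (by positivity) (hw s)
      set t := 2^k * w s
      rcases h0.eq_or_lt with h | h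
      · rw [← h, zero_mul, Real.zero_rpow hp0.ne']
      · have : t^p = t * t^(p-1) := by
          rw [← Real.rpow_one_add' h.le (by linarith)]; congr 1; ring
        rw [this]
        gcongr ?_ * ?_
        exact Real.rpow_le_rpow_of_nonpos h hs' (by linarith)

theorem final [CompleteSpace E] {p : ℝ} (hp0 : 0 < p) (hp1 : p < 1) (T : A →L[ℂ] E) (hT : PSumming p T) :
    IsCompactOperator T := by
  by_contra hnc
  obtain ⟨δ, hδ, e, he1, he2⟩ := noncompact T hnc
  obtain ⟨C, hC⟩ := psum' hp0 T hT
  obtain ⟨m, hm, hmT⟩ := dom T (one_sum hp0 hp1 T hC)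
  obtain ⟨c0, hc0, U, hU, htree⟩ := treelemma m hm T hmT δ hδ e he1 he2
  have hC0 := hC.1
  have hU0 : 0 < U^(p-1) := Real.rpow_pos_of_pos (by linarith) _
  set c1 := c0 * U^(p-1) with hc1
  have hc10 : 0 < c1 := by positivity
  set τ := c1/(8*(C+1)) with hτ
  have hτ0 : 0 < τ := by positivity
  set Q := τ^(1-2/p)/(p*(1-p)/6) with hQ
  obtain ⟨L, hL⟩ := exists_nat_gt (4*C*Q/(c1/2))
  rw [div_lt_iff₀ (by positivity)] at hL
  obtain ⟨x, hx0, hx1, hx2⟩ := htree L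
  have h1 := upper_est hp0 hp1 hτ0 T hC L x hx0 hx1
  have h2 : (L:ℝ) * c1 ≤ ∑ j ∈ range L, lev p (L-1-j) (fun s => ‖T (dif (red^[j] x) s)‖) := by
    calc (L:ℝ) * c1 = ∑ j ∈ range L, c1 := by rw [sum_const, card_range, nsmul_eq_mul]
      _ ≤ _ := sum_le_sum fun j hj => by
        obtain ⟨a, b⟩ := hx2 j (mem_range.1 hj)
        exact lower_est hp0 hp1 hU _ _ (fun s => norm_nonneg _) a b
  have h3 : 4*C*τ ≤ c1/2 := by
    rw [hτ, mul_div_assoc', div_le_iff₀ (by positivity)]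
    nlinarith
  have h4 : 4*C*τ*L ≤ c1/2*L := by gcongr
  rw [← hQ] at h1
  linarith
end final
end PS

/-- Let `𝒜` be a C*-algebra, `E` a Banach space and `0 < p < 1`.  Then every `p`-summing
operator `T : 𝒜 → E` is compact. -/
theorem pSumming_cstarAlgebra_isCompactOperator
    {A : Type*} [NormedRing A] [StarRing A] [CStarRing A] [NormedAlgebra ℂ A]
    [CompleteSpace A] [StarModule ℂ A]
    {E : Type*} [NormedAddCommGroup E] [NormedSpace ℂ E] [CompleteSpace E]
    {p : ℝ} (hp0 : 0 < p) (hp1 : p < 1)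
    (T : A →L[ℂ] E) (hT : PSumming p T) :
    IsCompactOperator T := by
  let : CStarAlgebra A :=
    { (inferInstance : NormedRing A), (inferInstance : StarRing A), (inferInstance : NormedAlgebra ℂ A) with
      complete := CompleteSpace.complete
      norm_mul_self_le := CStarRing.norm_mul_self_le
      star_smul := star_smul }
  let := CStarAlgebra.spectralOrder A
  have := CStarAlgebra.spectralOrderedRing A
  exact PS.final hp0 hp1 T hT
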